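/- arXiv:2403.16671 — 7 statements merged into one kernel-verified Lean document; each statement's English description precedes it below -/
import Mathlib

section
/- Let m ≥ 3 be odd. The dihedral Artin group with presentation ⟨a, b ∣ ₘ(a,b) = ₘ(b,a)⟩, where ₘ(a,b) denotes the alternating word abab··· of length m, is isomorphic to the torus knot group with presentation ⟨x, y ∣ x² = yᵐ⟩. -/
/-- The single relation `x² = yᵐ` of the torus knot group, over generators
indexed by `Bool` (`true ↦ x`, `false ↦ y`). -/
def torusRels (m : ℕ) : Set (FreeGroup Bool) :=
  {FreeGroup.of true ^ 2 * (FreeGroup.of false ^ m)⁻¹}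

/-- The torus knot group `⟨x, y ∣ x² = yᵐ⟩`. -/
abbrev TorusGrp (m : ℕ) : Type := PresentedGroup (torusRels m)

/-- The generator `x` of `⟨x, y ∣ x² = yᵐ⟩`. -/
def xg (m : ℕ) : TorusGrp m := PresentedGroup.of true

/-- The generator `y` of `⟨x, y ∣ x² = yᵐ⟩`. -/
def yg (m : ℕ) : TorusGrp m := PresentedGroup.of false

/-- The Garside element `Δ = x²` of `⟨x, y ∣ x² = yᵐ⟩`. -/
def Δg (m : ℕ) : TorusGrp m := xg m ^ 2

/-- `u` is `φ`-twisted conjugate to `v`: there is `w` with `v = φ(w)⁻¹ u w`. -/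
def twistedConj {G : Type*} [Group G] (φ : MulAut G) (u v : G) : Prop :=
  ∃ w : G, v = (φ w)⁻¹ * u * w

/-- The alternating product `abab⋯` with exactly `m` letters. -/
def altWord {M : Type*} [Monoid M] (m : ℕ) (a b : M) : M :=
  ((List.range m).map (fun i => if i % 2 = 0 then a else b)).prod

/-- The single relation `ₘ(a,b) = ₘ(b,a)` of the dihedral Artin group, over generators
indexed by `Bool` (`true ↦ a`, `false ↦ b`). -/
def artinRels (m : ℕ) : Set (FreeGroup Bool) :=
  {altWord m (FreeGroup.of true) (FreeGroup.of false) *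
    (altWord m (FreeGroup.of false) (FreeGroup.of true))⁻¹}

/-- The dihedral Artin group `⟨a, b ∣ ₘ(a,b) = ₘ(b,a)⟩`. -/
abbrev DihedralArtin (m : ℕ) : Type := PresentedGroup (artinRels m)

theorem altWord_two_mul {M : Type*} [Monoid M] (k : ℕ) (a b : M) :
    altWord (2 * k) a b = (a * b) ^ k := by
  induction k with
  | zero => simp [altWord]
  | succ k ih =>
    rw [pow_succ, ← ih]
    simp [altWord, mul_add, List.range_succ, Nat.add_mod]

theorem altWord_two_mul_add_one {M : Type*} [Monoid M] (k : ℕ) (a b : M) :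
    altWord (2 * k + 1) a b = (a * b) ^ k * a := by
  rw [← altWord_two_mul]
  simp [altWord, List.range_succ]

theorem altWord_two_mul_add_one' {M : Type*} [Monoid M] (k : ℕ) (a b : M) :
    altWord (2 * k + 1) a b = a * (b * a) ^ k := by
  rw [altWord_two_mul_add_one]
  exact (SemiconjBy.pow_right (show SemiconjBy a (b * a) (a * b) from
    (mul_assoc a b a).symm) k).eq.symm

theorem map_altWord {M N : Type*} [Monoid M] [Monoid N] (f : M →* N) (m : ℕ) (a b : M) :
    f (altWord m a b) = altWord m (f a) (f b) := by
  simp only [altWord, map_list_prod, List.map_map]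
  congr 2
  funext i
  exact apply_ite f _ _ _

/-- Elements `a`, `b` of a group with `ₘ(a,b) = ₘ(b,a)` define a homomorphism from the dihedral
Artin group. -/
def DihedralArtin.lift {G : Type*} [Group G] (m : ℕ) (a b : G)
    (h : altWord m a b = altWord m b a) : DihedralArtin m →* G :=
  PresentedGroup.toGroup (f := fun i => cond i a b) <| by
    rintro r rfl
    simp [map_altWord, h]

/-- Elements `x`, `y` of a group with `x² = yᵐ` define a homomorphism from the torus knot
group. -/
def TorusGrp.lift {G : Type*} [Group G] (m : ℕ) (x y : G) (h : x ^ 2 = y ^ m) : TorusGrp m →* G :=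
  PresentedGroup.toGroup (f := fun i => cond i x y) <| by
    rintro r rfl
    simp [h]

theorem xg_sq (m : ℕ) : xg m ^ 2 = yg m ^ m := by
  have h := PresentedGroup.mk_eq_mk_of_mul_inv_mem (rels := torusRels m) (Set.mem_singleton _)
  simp only [map_pow] at h
  exact h

theorem DihedralArtin.altWord_of (m : ℕ) :
    altWord m (PresentedGroup.of true : DihedralArtin m) (PresentedGroup.of false) =
      altWord m (PresentedGroup.of false) (PresentedGroup.of true) := by
  have h := PresentedGroup.mk_eq_mk_of_mul_inv_mem (rels := artinRels m) (Set.mem_singleton _)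
  simp only [map_altWord] at h
  exact h

theorem altWord_sq {G : Type*} [Group G] (k : ℕ) (a b : G)
    (h : altWord (2 * k + 1) a b = altWord (2 * k + 1) b a) :
    altWord (2 * k + 1) a b ^ 2 = (a * b) ^ (2 * k + 1) := by
  rw [sq]
  nth_rewrite 2 [h]
  rw [altWord_two_mul_add_one, altWord_two_mul_add_one',
    show 2 * k + 1 = k + 1 + k by ring, pow_add, pow_succ]
  simp only [mul_assoc]

theorem altWord_comm_of_sq_eq_pow {G : Type*} [Group G] (k : ℕ) (x y : G)
    (h : x ^ 2 = y ^ (2 * k + 1)) :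
    altWord (2 * k + 1) ((y ^ k)⁻¹ * x) (x⁻¹ * y ^ (k + 1)) =
      altWord (2 * k + 1) (x⁻¹ * y ^ (k + 1)) ((y ^ k)⁻¹ * x) := by
  have hy : (y ^ k)⁻¹ * x * (x⁻¹ * y ^ (k + 1)) = y := by rw [pow_succ]; group
  rw [altWord_two_mul_add_one, altWord_two_mul_add_one', hy, mul_inv_cancel_left, mul_assoc,
    ← pow_add, show k + 1 + k = 2 * k + 1 by ring, ← h, sq, inv_mul_cancel_left]

/-- For odd `m ≥ 3`, the dihedral Artin group `⟨a, b ∣ ₘ(a,b) = ₘ(b,a)⟩` is isomorphic to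
the torus knot group `⟨x, y ∣ x² = yᵐ⟩`. -/
theorem dihedralArtin_iso_torusKnotGroup (m : ℕ) (hm : 3 ≤ m) (hodd : Odd m) :
    Nonempty (DihedralArtin m ≃* TorusGrp m) := by
  obtain ⟨k, rfl⟩ := hodd
  let a : DihedralArtin (2 * k + 1) := PresentedGroup.of true
  let b : DihedralArtin (2 * k + 1) := PresentedGroup.of false
  let x := xg (2 * k + 1)
  let y := yg (2 * k + 1)
  have hab := DihedralArtin.altWord_of (2 * k + 1)
  have hxy := altWord_comm_of_sq_eq_pow k x y (xg_sq _)
  have hy : (y ^ k)⁻¹ * x * (x⁻¹ * y ^ (k + 1)) = y := by rw [pow_succ]; group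
  let f := DihedralArtin.lift _ _ _ hxy
  let g := TorusGrp.lift _ _ _ (altWord_sq k a b hab)
  have fa : f a = (y ^ k)⁻¹ * x := PresentedGroup.toGroup.of _
  have fb : f b = x⁻¹ * y ^ (k + 1) := PresentedGroup.toGroup.of _
  have gx : g x = altWord (2 * k + 1) a b := PresentedGroup.toGroup.of _
  have gy : g y = a * b := PresentedGroup.toGroup.of _
  refine ⟨f.toMulEquiv g (PresentedGroup.ext ?_) (PresentedGroup.ext ?_)⟩
  · rintro (_ | _)
    · change g (f b) = b
      rw [fb, map_mul, map_inv, map_pow, gx, gy, altWord_two_mul_add_one, pow_succ]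
      group
    · change g (f a) = a
      rw [fa, map_mul, map_inv, map_pow, gx, gy, altWord_two_mul_add_one, inv_mul_cancel_left]
  · rintro (_ | _)
    · change f (g y) = y
      rw [gy, map_mul, fa, fb, hy]
    · change f (g x) = x
      rw [gx, map_altWord, fa, fb, altWord_two_mul_add_one, hy, mul_inv_cancel_left]
end

section
/- Let m ≥ 3 be odd, let G(m) = ⟨x, y ∣ x² = yᵐ⟩, and let φ be the automorphism with φ(x) = x⁻¹, φ(y) = y⁻¹. For every integer t ≥ 0: if t is even then xᵗ ∼_φ 1, and if t is odd then xᵗ ∼_φ x and xᵗ ∼_φ x⁻¹. -/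
/-- For every `t ≥ 0`: if `t` is even then `xᵗ ∼_φ 1`; if `t` is odd then `xᵗ ∼_φ x` and
`xᵗ ∼_φ x⁻¹`. -/
theorem twistedConj_x_pow (m : ℕ) (hm : 3 ≤ m) (hodd : Odd m)
    (φ : MulAut (TorusGrp m)) (hφx : φ (xg m) = (xg m)⁻¹) (hφy : φ (yg m) = (yg m)⁻¹)
    (t : ℕ) :
    (Even t → twistedConj φ (xg m ^ t) 1) ∧
    (Odd t → twistedConj φ (xg m ^ t) (xg m) ∧ twistedConj φ (xg m ^ t) (xg m)⁻¹) := by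
  have key (k n : ℤ) (h : (t : ℤ) + 2 * k = n) :
      xg m ^ n = (φ (xg m ^ k))⁻¹ * xg m ^ t * xg m ^ k := by
    rw [map_zpow, hφx, inv_zpow, inv_inv, ← zpow_natCast, ← zpow_add, ← zpow_add, ← h]
    congr 1
    ring
  refine ⟨?_, ?_⟩
  · rintro ⟨s, hs⟩
    exact ⟨xg m ^ (-s : ℤ), by simpa using key (-s) 0 (by omega)⟩
  · rintro ⟨s, hs⟩
    refine ⟨⟨xg m ^ (-s : ℤ), ?_⟩, ⟨xg m ^ (-s - 1 : ℤ), ?_⟩⟩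
    · rw [← key (-s) 1 (by omega), zpow_one]
    · rw [← key (-s - 1) (-1) (by omega), zpow_neg_one]
end

section
/- Let m ≥ 3 be odd, let G(m) = ⟨x, y ∣ x² = yᵐ⟩, and let φ be the automorphism with φ(x) = x⁻¹, φ(y) = y⁻¹. For every integer t ≥ 0 and every integer c: if c and t have the same parity then y^{t+mc} ∼_φ 1, and if c and t have opposite parity then y^{t+mc} ∼_φ y and y^{t+mc} ∼_φ y⁻¹. -/
/-- If `φ` inverts `y`, then powers of `y` whose exponents differ by an even integer are
`φ`-twisted conjugate. -/
theorem twistedConj_zpow_of_even_sub {G : Type*} [Group G] {φ : MulAut G} {y : G}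
    (hφ : φ y = y⁻¹) {a b : ℤ} (h : Even (b - a)) : twistedConj φ (y ^ a) (y ^ b) := by
  obtain ⟨k, hk⟩ := h
  refine ⟨y ^ k, ?_⟩
  rw [map_zpow, hφ, inv_zpow, inv_inv, ← zpow_add, ← zpow_add]
  congr 1
  lia

/-- For every `t ≥ 0` and every integer `c`: if `c` and `t` have the same parity then
`y^{t+mc} ∼_φ 1`; if they have opposite parity then `y^{t+mc} ∼_φ y` and `y^{t+mc} ∼_φ y⁻¹`. -/
theorem twistedConj_y_pow (m : ℕ) (hm : 3 ≤ m) (hodd : Odd m)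
    (φ : MulAut (TorusGrp m)) (hφx : φ (xg m) = (xg m)⁻¹) (hφy : φ (yg m) = (yg m)⁻¹)
    (t : ℕ) (c : ℤ) :
    ((Even c ↔ Even (t : ℤ)) → twistedConj φ (yg m ^ ((t : ℤ) + (m : ℤ) * c)) 1) ∧
    (¬(Even c ↔ Even (t : ℤ)) →
      twistedConj φ (yg m ^ ((t : ℤ) + (m : ℤ) * c)) (yg m) ∧
      twistedConj φ (yg m ^ ((t : ℤ) + (m : ℤ) * c)) (yg m)⁻¹) := by
  have hm' : ¬ Even (m : ℤ) := by simpa using hodd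
  refine ⟨fun h => ?_, fun h => ⟨?_, ?_⟩⟩
  · rw [← zpow_zero (yg m)]
    apply twistedConj_zpow_of_even_sub hφy
    simp only [Int.even_sub, Int.even_add, Int.even_mul, Even.zero]
    tauto
  · nth_rewrite 2 [← zpow_one (yg m)]
    apply twistedConj_zpow_of_even_sub hφy
    simp only [Int.even_sub, Int.even_add, Int.even_mul, Int.not_even_one]
    tauto
  · rw [← zpow_neg_one (yg m)]
    apply twistedConj_zpow_of_even_sub hφy
    simp only [Int.even_sub, Int.even_add, Int.even_mul, even_neg, Int.not_even_one]
    tauto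
end

section
/- Let m ≥ 3 be odd, let G(m) = ⟨x, y ∣ x² = yᵐ⟩ with Garside element Δ = x², and let φ be the automorphism with φ(x) = x⁻¹, φ(y) = y⁻¹. For every v ∈ G(m), every ε₁, ε₂ ∈ {1, −1}, and every integer c: x^{ε₁} v x^{ε₂} Δ^{c} ∼_φ x^{ε₁−ε₂} v Δ^{c}. In particular, if ε₁ = ε₂ then x^{ε₁} v x^{ε₂} Δ^{c} ∼_φ v Δ^{c}, and if ε₁ ≠ ε₂ then x^{ε₁} v x^{ε₂} Δ^{c} ∼_φ v Δ^{c+ε₁}. (Rule (R2) is invariant under ∼_φ.) -/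
/-- The Garside element `Δ` is central in `⟨x, y ∣ x² = yᵐ⟩`. -/
theorem Δg_mem_center (m : ℕ) : Δg m ∈ Subgroup.center (TorusGrp m) := by
  have hxy : Δg m = yg m ^ m := by
    have h : PresentedGroup.mk (torusRels m)
        (FreeGroup.of true ^ 2 * (FreeGroup.of false ^ m)⁻¹) = 1 :=
      PresentedGroup.one_of_mem rfl
    rw [map_mul, map_inv, map_pow, map_pow, mul_inv_eq_one] at h
    exact h
  suffices h : Subgroup.centralizer {Δg m} = ⊤ by
    rw [Subgroup.mem_center_iff]
    intro g
    have hg : g ∈ Subgroup.centralizer {Δg m} := h ▸ Subgroup.mem_top g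
    exact (Subgroup.mem_centralizer_singleton_iff.mp hg)
  rw [eq_top_iff, ← PresentedGroup.closure_range_of, Subgroup.closure_le]
  rintro _ ⟨b, rfl⟩
  rw [SetLike.mem_coe, Subgroup.mem_centralizer_singleton_iff]
  cases b with
  | true => exact (Commute.self_pow (xg m) 2).eq
  | false => rw [hxy]; exact (Commute.self_pow (yg m) m).eq

/-- If `φ` inverts `x`, a right factor `xᵇ` moves to the left as `x⁻ᵇ` up to twisted conjugacy,
past a power of `x²`. -/
theorem twistedConj_zpow_mul_mul_zpow {G : Type*} [Group G] (φ : MulAut G) {x : G}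
    (hx : φ x = x⁻¹) (v : G) (a b c : ℤ) :
    twistedConj φ (x ^ a * v * x ^ b * (x ^ 2) ^ c) (x ^ (a - b) * v * (x ^ 2) ^ c) := by
  refine ⟨x ^ (-b), ?_⟩
  have hc : Commute ((x ^ 2) ^ c) (x ^ (-b)) :=
    (((Commute.refl x).pow_left 2).zpow_left c).zpow_right (-b)
  rw [map_zpow, hx, mul_assoc _ _ (x ^ (-b)), mul_assoc _ _ (x ^ (-b)), hc.eq]
  group

/-- Rule (R2) is invariant under `∼_φ`: `x^{ε₁} v x^{ε₂} Δᶜ ∼_φ x^{ε₁−ε₂} v Δᶜ`; in particular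
it is `∼_φ v Δᶜ` when `ε₁ = ε₂` and `∼_φ v Δ^{c+ε₁}` when `ε₁ ≠ ε₂`. -/
theorem twistedConj_R2 (m : ℕ) (hm : 3 ≤ m) (hodd : Odd m)
    (φ : MulAut (TorusGrp m)) (hφx : φ (xg m) = (xg m)⁻¹) (hφy : φ (yg m) = (yg m)⁻¹)
    (v : TorusGrp m) (ε₁ ε₂ : ℤ) (hε₁ : ε₁ = 1 ∨ ε₁ = -1) (hε₂ : ε₂ = 1 ∨ ε₂ = -1) (c : ℤ) :
    twistedConj φ (xg m ^ ε₁ * v * xg m ^ ε₂ * Δg m ^ c) (xg m ^ (ε₁ - ε₂) * v * Δg m ^ c) ∧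
    (ε₁ = ε₂ →
      twistedConj φ (xg m ^ ε₁ * v * xg m ^ ε₂ * Δg m ^ c) (v * Δg m ^ c)) ∧
    (ε₁ ≠ ε₂ →
      twistedConj φ (xg m ^ ε₁ * v * xg m ^ ε₂ * Δg m ^ c) (v * Δg m ^ (c + ε₁))) := by
  have key := twistedConj_zpow_mul_mul_zpow φ hφx v ε₁ ε₂ c
  refine ⟨key, fun h => ?_, fun h => ?_⟩
  · simpa [Δg, h] using key
  · have hx : xg m ^ (ε₁ - ε₂) = Δg m ^ ε₁ := by
      rw [Δg, ← zpow_natCast, ← zpow_mul]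
      congr 1
      omega
    have hv : v * Δg m ^ ε₁ = Δg m ^ ε₁ * v :=
      Subgroup.mem_center_iff.mp (zpow_mem (Δg_mem_center m) ε₁) v
    rwa [add_comm, zpow_add, ← mul_assoc, hv, ← hx]
end

section
/- Let m ≥ 3 be odd, let G(m) = ⟨x, y ∣ x² = yᵐ⟩ with Garside element Δ = x² = yᵐ, and let φ be the automorphism with φ(x) = x⁻¹, φ(y) = y⁻¹. For every v ∈ G(m), all integers b₁, bₙ, and every integer c: y^{b₁} v y^{bₙ} Δ^{c} ∼_φ y^{b₁−bₙ} v Δ^{c}. In particular, if b₁ = bₙ then y^{b₁} v y^{bₙ} Δ^{c} ∼_φ v Δ^{c}, and if b₁ − bₙ = εm with ε ∈ {1, −1} then y^{b₁} v y^{bₙ} Δ^{c} ∼_φ v Δ^{c+ε}. (Rule (R3) is invariant under ∼_φ.) -/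
theorem Δg_eq_yg_pow (m : ℕ) : Δg m = yg m ^ m := by
  have h : PresentedGroup.mk (torusRels m)
      (FreeGroup.of true ^ 2 * (FreeGroup.of false ^ m)⁻¹) = 1 :=
    PresentedGroup.one_of_mem rfl
  rw [map_mul, map_inv, map_pow, map_pow, mul_inv_eq_one] at h
  exact h

theorem commute_Δg (m : ℕ) (v : TorusGrp m) : Commute (Δg m) v := by
  have hv : v ∈ Subgroup.centralizer {Δg m} := by
    refine (?_ : (⊤ : Subgroup (TorusGrp m)) ≤ _) (Subgroup.mem_top v)
    rw [← PresentedGroup.closure_range_of, Subgroup.closure_le]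
    rintro _ ⟨b, rfl⟩
    rw [SetLike.mem_coe, Subgroup.mem_centralizer_singleton_iff]
    cases b with
    | true => exact (Commute.self_pow (xg m) 2).eq
    | false =>
      rw [Δg_eq_yg_pow]
      exact (Commute.self_pow (yg m) m).eq
  exact (Subgroup.mem_centralizer_singleton_iff.mp hv).symm

/-- Rule (R3) is invariant under `∼_φ`: `y^{b₁} v y^{bₙ} Δᶜ ∼_φ y^{b₁−bₙ} v Δᶜ`; in particular
it is `∼_φ v Δᶜ` when `b₁ = bₙ`, and `∼_φ v Δ^{c+ε}` when `b₁ − bₙ = εm` with `ε ∈ {1, −1}`. -/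
theorem twistedConj_R3 (m : ℕ) (hm : 3 ≤ m) (hodd : Odd m)
    (φ : MulAut (TorusGrp m)) (hφx : φ (xg m) = (xg m)⁻¹) (hφy : φ (yg m) = (yg m)⁻¹)
    (v : TorusGrp m) (b₁ bₙ : ℤ) (c : ℤ) :
    twistedConj φ (yg m ^ b₁ * v * yg m ^ bₙ * Δg m ^ c) (yg m ^ (b₁ - bₙ) * v * Δg m ^ c) ∧
    (b₁ = bₙ →
      twistedConj φ (yg m ^ b₁ * v * yg m ^ bₙ * Δg m ^ c) (v * Δg m ^ c)) ∧
    (∀ ε : ℤ, (ε = 1 ∨ ε = -1) → b₁ - bₙ = ε * (m : ℤ) →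
      twistedConj φ (yg m ^ b₁ * v * yg m ^ bₙ * Δg m ^ c) (v * Δg m ^ (c + ε))) := by
  have key : twistedConj φ (yg m ^ b₁ * v * yg m ^ bₙ * Δg m ^ c)
      (yg m ^ (b₁ - bₙ) * v * Δg m ^ c) := by
    refine ⟨yg m ^ (-bₙ), ?_⟩
    have hc := ((commute_Δg m (yg m ^ (-bₙ))).zpow_left c).eq
    have hφ : (φ (yg m ^ (-bₙ)))⁻¹ = yg m ^ (-bₙ) := by
      rw [map_zpow, hφy, inv_zpow, inv_inv]
    rw [hφ, mul_assoc _ _ (yg m ^ (-bₙ)), mul_assoc _ (Δg m ^ c), hc, sub_eq_neg_add, zpow_add]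
    group
  refine ⟨key, ?_, ?_⟩
  · rintro rfl
    simpa using key
  · rintro ε - h
    have hΔ : yg m ^ (ε * (m : ℤ)) = Δg m ^ ε := by
      rw [Δg_eq_yg_pow, ← zpow_natCast, ← zpow_mul, mul_comm]
    rwa [h, hΔ, ((commute_Δg m v).zpow_left ε).eq, mul_assoc v, ← zpow_add,
      add_comm ε] at key
end

section
/- Let m ≥ 3 be odd, let G(m) = ⟨x, y ∣ x² = yᵐ⟩, and let φ be the automorphism with φ(x) = x⁻¹, φ(y) = y⁻¹. For every g ∈ G(m) there exists h ∈ G(m) with h ∼_φ g and |h| ≤ |g| such that either h ∈ {1, x, x⁻¹, y, y⁻¹}, or there exists a geodesic word for h (a list of |h| letters from X = {x, x⁻¹, y, y⁻¹} whose product is h) whose first letter lies in {x, x⁻¹} and whose last letter lies in {y, y⁻¹}, or whose first letter lies in {y, y⁻¹} and whose last letter lies in {x, x⁻¹}. -/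
/-- The free product generating set `X = {x, x⁻¹, y, y⁻¹}`. -/
def genSet (m : ℕ) : Set (TorusGrp m) := {xg m, (xg m)⁻¹, yg m, (yg m)⁻¹}

/-- The word length of `g` over `X = {x, x⁻¹, y, y⁻¹}`: the least `n` such that `g` is a
product of `n` elements of `X`. -/
noncomputable def wordLen (m : ℕ) (g : TorusGrp m) : ℕ :=
  sInf {n | ∃ l : List (TorusGrp m), l.length = n ∧ (∀ a ∈ l, a ∈ genSet m) ∧ l.prod = g}

namespace TorusGrp

/-- The element of `TorusGrp m` given by a signed letter: `(s, true)` is the generator indexed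
by `s` and `(s, false)` its inverse. -/
def letter (m : ℕ) (p : Bool × Bool) : TorusGrp m :=
  cond p.2 (PresentedGroup.of p.1) (PresentedGroup.of p.1)⁻¹

/-- The element of `TorusGrp m` spelled by a word in the signed letters. -/
def eval (m : ℕ) (w : List (Bool × Bool)) : TorusGrp m := (w.map (letter m)).prod

/-- The formal inverse of a signed letter. -/
def flip (p : Bool × Bool) : Bool × Bool := (p.1, !p.2)

theorem letter_flip (m : ℕ) (p : Bool × Bool) : letter m (flip p) = (letter m p)⁻¹ := by
  obtain ⟨s, _ | _⟩ := p <;> simp [letter, flip]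

theorem eval_nil (m : ℕ) : eval m [] = 1 := rfl

theorem eval_cons (m : ℕ) (p : Bool × Bool) (w : List (Bool × Bool)) :
    eval m (p :: w) = letter m p * eval m w := by
  simp [eval]

theorem eval_append (m : ℕ) (v w : List (Bool × Bool)) :
    eval m (v ++ w) = eval m v * eval m w := by
  simp [eval]

theorem eval_singleton (m : ℕ) (p : Bool × Bool) : eval m [p] = letter m p := by
  simp [eval]

theorem range_letter (m : ℕ) : Set.range (letter m) = genSet m := by
  ext a
  simp only [Set.mem_range, Prod.exists, Bool.exists_bool, letter, genSet, xg, yg,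
    Set.mem_insert_iff, Set.mem_singleton_iff, cond_true, cond_false, eq_comm (b := a)]
  tauto

theorem letter_mem_genSet (m : ℕ) (p : Bool × Bool) : letter m p ∈ genSet m :=
  range_letter m ▸ Set.mem_range_self p

theorem eval_surjective (m : ℕ) : Function.Surjective (eval m) := by
  intro g
  obtain ⟨f, rfl⟩ := PresentedGroup.mk_surjective (torusRels m) g
  obtain ⟨w, rfl⟩ := Quot.exists_rep f
  refine ⟨w, ?_⟩
  have h : PresentedGroup.mk (torusRels m) = FreeGroup.lift PresentedGroup.of := by
    ext s
    simp [PresentedGroup.of]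
  rw [h]
  exact (FreeGroup.lift_mk (f := PresentedGroup.of (rels := torusRels m)) (L := w)).symm

theorem wordLen_eval_le (m : ℕ) (w : List (Bool × Bool)) : wordLen m (eval m w) ≤ w.length := by
  refine Nat.sInf_le ⟨w.map (letter m), by simp, ?_, rfl⟩
  intro a ha
  obtain ⟨p, -, rfl⟩ := List.mem_map.1 ha
  exact letter_mem_genSet m p

/-- Every element is spelled by a geodesic word. -/
theorem exists_geodesic (m : ℕ) (g : TorusGrp m) :
    ∃ w, eval m w = g ∧ w.length = wordLen m g := by
  have hne : {n | ∃ l : List (TorusGrp m), l.length = n ∧ (∀ a ∈ l, a ∈ genSet m) ∧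
      l.prod = g}.Nonempty := by
    obtain ⟨w, rfl⟩ := eval_surjective m g
    refine ⟨_, w.map (letter m), rfl, ?_, rfl⟩
    intro a ha
    obtain ⟨p, -, rfl⟩ := List.mem_map.1 ha
    exact letter_mem_genSet m p
  obtain ⟨l, hl, hmem, hprod⟩ := Nat.sInf_mem hne
  rw [← range_letter] at hmem
  have hl' : l ∈ Set.range (List.map (letter m)) := by
    rw [Set.range_list_map]
    exact hmem
  obtain ⟨w, rfl⟩ := hl'
  exact ⟨w, hprod, by simpa [wordLen] using hl⟩

/-- `h` is spelled by a geodesic word whose first and last letters belong to different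
generators. -/
def HasOppositeEnds (m : ℕ) (h : TorusGrp m) : Prop :=
  ∃ a l b, a.1 ≠ b.1 ∧ eval m (a :: (l ++ [b])) = h ∧ (a :: (l ++ [b])).length = wordLen m h

/-- `g` is twisted conjugate to an element of length at most `n` which is trivial, a letter, or
has a geodesic with opposite ends. -/
def HasRep (m : ℕ) (φ : MulAut (TorusGrp m)) (n : ℕ) (g : TorusGrp m) : Prop :=
  ∃ h, twistedConj φ h g ∧ wordLen m h ≤ n ∧
    (h = 1 ∨ h ∈ genSet m ∨ HasOppositeEnds m h)

section

variable {m : ℕ} {φ : MulAut (TorusGrp m)}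

theorem twistedConj_refl (g : TorusGrp m) : twistedConj φ g g := ⟨1, by simp⟩

theorem twistedConj_trans {u v w : TorusGrp m} (huv : twistedConj φ u v)
    (hvw : twistedConj φ v w) : twistedConj φ u w := by
  obtain ⟨s, rfl⟩ := huv
  obtain ⟨t, rfl⟩ := hvw
  exact ⟨s * t, by simp [mul_assoc]⟩

theorem HasRep.mono {n k : ℕ} {g : TorusGrp m} (h : HasRep m φ n g) (hnk : n ≤ k) :
    HasRep m φ k g := by
  obtain ⟨r, hr, hlen, hcases⟩ := h
  exact ⟨r, hr, hlen.trans hnk, hcases⟩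

theorem HasRep.of_twistedConj {n : ℕ} {u v : TorusGrp m} (h : HasRep m φ n u)
    (huv : twistedConj φ u v) : HasRep m φ n v := by
  obtain ⟨r, hr, hrest⟩ := h
  exact ⟨r, twistedConj_trans hr huv, hrest⟩

theorem map_letter (hφx : φ (xg m) = (xg m)⁻¹) (hφy : φ (yg m) = (yg m)⁻¹)
    (p : Bool × Bool) : φ (letter m p) = (letter m p)⁻¹ := by
  obtain ⟨_ | _, _ | _⟩ := p
  · simpa [letter, yg, inv_eq_iff_eq_inv] using hφy
  · simpa [letter, yg] using hφy
  · simpa [letter, xg, inv_eq_iff_eq_inv] using hφx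
  · simpa [letter, xg] using hφx

theorem twistedConj_letter_mul_mul (hφ : ∀ p, φ (letter m p) = (letter m p)⁻¹)
    (p : Bool × Bool) (u : TorusGrp m) :
    twistedConj φ u (letter m p * u * letter m p) :=
  ⟨letter m p, by simp [hφ]⟩

/-- The first letter of a word can be moved, inverted, to its end. -/
theorem twistedConj_rotate (hφ : ∀ p, φ (letter m p) = (letter m p)⁻¹)
    (p : Bool × Bool) (w : List (Bool × Bool)) :
    twistedConj φ (eval m (w ++ [flip p])) (eval m (p :: w)) := by
  have h := twistedConj_letter_mul_mul hφ p (eval m (w ++ [flip p]))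
  simpa [eval_cons, eval_append, eval_nil, letter_flip, mul_assoc] using h

theorem commute_letter_eval {a : Bool × Bool} {w : List (Bool × Bool)}
    (hw : ∀ c ∈ w, c.1 = a.1) : Commute (letter m a) (eval m w) := by
  refine Commute.list_prod_right _ _ fun c hc => ?_
  obtain ⟨⟨s, e⟩, hp, rfl⟩ := List.mem_map.1 hc
  obtain ⟨t, d⟩ := a
  obtain rfl : s = t := hw _ hp
  cases d <;> cases e <;> simp [letter]

/-- A word with opposite ends is geodesic or spells an element of smaller length. -/
theorem hasRep_of_ne {n : ℕ}
    (ih : ∀ w : List (Bool × Bool), w.length < n → HasRep m φ w.length (eval m w))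
    {a b : Bool × Bool} {l : List (Bool × Bool)} (hab : a.1 ≠ b.1)
    (hn : (a :: (l ++ [b])).length = n) : HasRep m φ n (eval m (a :: (l ++ [b]))) := by
  obtain ⟨w, hw, hlen⟩ := exists_geodesic m (eval m (a :: (l ++ [b])))
  have hle := wordLen_eval_le m (a :: (l ++ [b]))
  rcases hle.lt_or_eq with hlt | heq
  · rw [← hw]
    exact (ih w (by omega)).mono (by omega)
  · exact ⟨_, twistedConj_refl _, hle.trans hn.le, Or.inr (Or.inr ⟨a, l, b, hab, rfl, heq.symm⟩)⟩

/-- Rotating away the initial run `p` of letters in one generator leaves a word with opposite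
ends. -/
theorem hasRep_of_run (hφ : ∀ p, φ (letter m p) = (letter m p)⁻¹) {n : ℕ}
    (ih : ∀ w : List (Bool × Bool), w.length < n → HasRep m φ w.length (eval m w))
    {a : Bool × Bool} (p : List (Bool × Bool)) :
    ∀ (l : List (Bool × Bool)) (b : Bool × Bool), (∀ c ∈ p, c.1 = b.1) → a.1 ≠ b.1 →
      (p ++ a :: (l ++ [b])).length = n → HasRep m φ n (eval m (p ++ a :: (l ++ [b]))) := by
  induction p with
  | nil => exact fun l b _ hab hn => hasRep_of_ne ih hab hn
  | cons c p ihp =>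
    intro l b hp hab hn
    have hc : c.1 = b.1 := hp c (by simp)
    have h := ihp (l ++ [b]) (flip c)
      (fun d hd => (hp d (by simp [hd])).trans hc.symm) (by simpa [flip, hc] using hab)
      (by simp at hn ⊢; omega)
    refine h.of_twistedConj ?_
    simpa using twistedConj_rotate hφ c (p ++ a :: (l ++ [b]))

theorem hasRep_eval (hφ : ∀ p, φ (letter m p) = (letter m p)⁻¹) (w : List (Bool × Bool)) :
    HasRep m φ w.length (eval m w) := by
  induction hn : w.length using Nat.strong_induction_on generalizing w with
  | _ n ih =>
  replace ih : ∀ v : List (Bool × Bool), v.length < n → HasRep m φ v.length (eval m v) :=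
    fun v hv => ih _ hv v rfl
  have hlen := wordLen_eval_le m w
  rcases w with _ | ⟨a, w⟩
  · exact ⟨_, twistedConj_refl _, hlen.trans hn.le, Or.inl rfl⟩
  rcases List.eq_nil_or_concat' w with rfl | ⟨l, b, rfl⟩
  · exact ⟨_, twistedConj_refl _, hlen.trans hn.le,
      Or.inr (Or.inl (eval_singleton m a ▸ letter_mem_genSet m a))⟩
  by_cases hab : a.1 = b.1
  swap
  · exact hasRep_of_ne ih hab hn
  by_cases hl : ∀ c ∈ l, c.1 = a.1
  · have hrep : HasRep m φ n (eval m l) := by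
      simp only [List.length_cons, List.length_append, List.length_nil] at hn
      exact (ih l (by omega)).mono (by omega)
    by_cases h : a.2 = b.2
    · obtain rfl : a = b := Prod.ext hab h
      refine hrep.of_twistedConj ?_
      simpa [eval_cons, eval_append, eval_nil, mul_assoc] using
        twistedConj_letter_mul_mul hφ a (eval m l)
    · obtain rfl : b = flip a := Prod.ext hab.symm (by simpa [flip, Bool.eq_not] using Ne.symm h)
      have hcomm := (commute_letter_eval (m := m) hl).eq
      simpa [eval_cons, eval_append, eval_nil, letter_flip, ← mul_assoc, hcomm] using hrep
  · push Not at hl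
    obtain ⟨c, hc, hca⟩ := hl
    obtain ⟨q, d, r, rfl, hd, hq⟩ : ∃ q d r, l = q ++ d :: r ∧ d.1 ≠ a.1 ∧
        ∀ e ∈ q, e.1 = a.1 := by
      obtain ⟨d, q, r, hq, hd, rfl, -⟩ :=
        List.exists_of_eraseP (p := fun e => e.1 != a.1) hc (by simpa using hca)
      exact ⟨q, d, r, rfl, by simpa using hd, by simpa using hq⟩
    have := hasRep_of_run hφ ih (a := d) (a :: q) r b
      (by simpa [hab] using fun s e h => (hq (s, e) h).trans hab) (by rwa [← hab])
      (by simpa using hn)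
    simpa using this

end

end TorusGrp

/-- Every `g` is `φ`-twisted conjugate to some `h` with `|h| ≤ |g|` such that either
`h ∈ {1, x, x⁻¹, y, y⁻¹}`, or `h` has a geodesic word starting with a letter in `{x, x⁻¹}`
and ending with a letter in `{y, y⁻¹}`, or vice versa. -/
theorem exists_twisted_rep_opposite_ends (m : ℕ) (hm : 3 ≤ m) (hodd : Odd m)
    (φ : MulAut (TorusGrp m)) (hφx : φ (xg m) = (xg m)⁻¹) (hφy : φ (yg m) = (yg m)⁻¹)
    (g : TorusGrp m) :
    ∃ h : TorusGrp m, twistedConj φ h g ∧ wordLen m h ≤ wordLen m g ∧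
      (h ∈ ({1, xg m, (xg m)⁻¹, yg m, (yg m)⁻¹} : Set (TorusGrp m)) ∨
        ∃ (a : TorusGrp m) (l' : List (TorusGrp m)) (b : TorusGrp m),
          (∀ c ∈ a :: (l' ++ [b]), c ∈ genSet m) ∧
          (a :: (l' ++ [b])).prod = h ∧
          (a :: (l' ++ [b])).length = wordLen m h ∧
          ((a ∈ ({xg m, (xg m)⁻¹} : Set (TorusGrp m)) ∧
              b ∈ ({yg m, (yg m)⁻¹} : Set (TorusGrp m))) ∨
            (a ∈ ({yg m, (yg m)⁻¹} : Set (TorusGrp m)) ∧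
              b ∈ ({xg m, (xg m)⁻¹} : Set (TorusGrp m))))) := by
  obtain ⟨w, rfl, hw⟩ := TorusGrp.exists_geodesic m g
  obtain ⟨h, hconj, hlen, hcases⟩ :=
    TorusGrp.hasRep_eval (TorusGrp.map_letter hφx hφy) w
  refine ⟨h, hconj, hlen.trans hw.le, ?_⟩
  rcases hcases with rfl | hgen | ⟨a, l, b, hab, rfl, hgeo⟩
  · exact Or.inl (Set.mem_insert _ _)
  · exact Or.inl (Set.mem_insert_of_mem _ hgen)
  refine Or.inr ⟨TorusGrp.letter m a, l.map (TorusGrp.letter m), TorusGrp.letter m b,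
    ?_, by simp [TorusGrp.eval], by simpa using hgeo, ?_⟩
  · intro c hc
    have hc' : c ∈ (a :: (l ++ [b])).map (TorusGrp.letter m) := by simpa using hc
    obtain ⟨p, -, rfl⟩ := List.mem_map.1 hc'
    exact TorusGrp.letter_mem_genSet m p
  · obtain ⟨_ | _, _ | _⟩ := a <;> obtain ⟨_ | _, _ | _⟩ := b <;>
      simp [TorusGrp.letter, xg, yg] at hab ⊢
end

section
/- Let m ≥ 3 be odd, let G(m) = ⟨x, y ∣ x² = yᵐ⟩, and let φ be the automorphism with φ(x) = x⁻¹, φ(y) = y⁻¹. Let g ∈ G(m), and let n be the minimum of the word lengths |h| over all h ∈ G(m) with h ∼_φ g. If n ≥ 2, then the set {h ∈ G(m) : h ∼_φ g and |h| = n} of minimal-length elements of the φ-twisted conjugacy class of g is finite of cardinality at most n(n+1). -/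
namespace TorusKnot

open List

/-- The distance from `a` to `0` in `ℤ/m`. -/
def nrm {m : ℕ} (a : ZMod m) : ℕ := a.valMinAbs.natAbs

section nrm

variable {m : ℕ}

@[simp] theorem nrm_zero : nrm (0 : ZMod m) = 0 := by simp [nrm]

theorem nrm_cast_le [NeZero m] (A : ℤ) : nrm (A : ZMod m) ≤ A.natAbs :=
  ZMod.natAbs_min_of_le_div_two m _ A (by simp) (ZMod.natAbs_valMinAbs_le _)

theorem two_mul_nrm_lt (hodd : Odd m) (a : ZMod m) : 2 * nrm a < m := by
  have : NeZero m := ⟨by rintro rfl; simp at hodd⟩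
  have := ZMod.natAbs_valMinAbs_le a
  obtain ⟨k, rfl⟩ := hodd
  unfold nrm
  omega

theorem eq_of_cast_eq {A B : ℤ} (h : (A : ZMod m) = B) (hlt : (A - B).natAbs < m) : A = B := by
  have h1 : (m : ℤ) ∣ A - B := (ZMod.intCast_eq_intCast_iff_dvd_sub B A m).1 h.symm
  have := Int.eq_zero_of_dvd_of_natAbs_lt_natAbs h1 (by simpa using hlt)
  omega

theorem nrm_add_le (a b : ZMod m) : nrm (a + b) ≤ nrm a + nrm b :=
  (ZMod.natAbs_valMinAbs_add_le a b).trans (Int.natAbs_add_le _ _)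

theorem nrm_neg (a : ZMod m) : nrm (-a) = nrm a := ZMod.natAbs_valMinAbs_neg a

end nrm

section group

variable {m : ℕ}

theorem xg_mul_self : xg m * xg m = Δg m := (pow_two _).symm

theorem yg_pow : yg m ^ m = Δg m := by
  have h : PresentedGroup.mk (torusRels m)
      (FreeGroup.of true ^ 2 * (FreeGroup.of false ^ m)⁻¹) = 1 :=
    PresentedGroup.one_of_mem (Set.mem_singleton _)
  rw [map_mul, map_inv, mul_inv_eq_one, map_pow, map_pow] at h
  exact h.symm

theorem induction_left {p : TorusGrp m → Prop} (one : p 1)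
    (mul : ∀ a ∈ genSet m, ∀ g, p g → p (a * g)) (g : TorusGrp m) : p g := by
  have hg : g ∈ Subgroup.closure (Set.range (PresentedGroup.of (rels := torusRels m))) := by
    rw [PresentedGroup.closure_range_of]; trivial
  induction hg using Subgroup.closure_induction_left with
  | one => exact one
  | mul_left a ha y _ hy =>
    obtain ⟨_ | _, rfl⟩ := ha
    · exact mul (yg m) (by simp [genSet]) _ hy
    · exact mul (xg m) (by simp [genSet]) _ hy
  | inv_mul_cancel a ha y _ hy =>
    obtain ⟨_ | _, rfl⟩ := ha
    · exact mul (yg m)⁻¹ (by simp [genSet]) _ hy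
    · exact mul (xg m)⁻¹ (by simp [genSet]) _ hy

theorem commute_Δg (g : TorusGrp m) : Commute (Δg m) g := by
  induction g using induction_left with
  | one => exact Commute.one_right _
  | mul a ha g hg =>
    refine Commute.mul_right ?_ hg
    have hx : Commute (Δg m) (xg m) := (Commute.refl (xg m)).pow_left 2
    have hy : Commute (Δg m) (yg m) := by
      rw [← yg_pow]; exact (Commute.refl (yg m)).pow_left m
    rcases ha with rfl | rfl | rfl | rfl
    exacts [hx, hx.inv_right, hy, hy.inv_right]

theorem mul_Δg_zpow (g : TorusGrp m) (k : ℤ) : g * Δg m ^ k = Δg m ^ k * g :=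
  ((commute_Δg g).zpow_left k).eq.symm

theorem mul_Δg_zpow_mul (g h : TorusGrp m) (k : ℤ) : g * (Δg m ^ k * h) = Δg m ^ k * (g * h) := by
  rw [← mul_assoc, mul_Δg_zpow, mul_assoc]

theorem xg_inv : (xg m)⁻¹ = Δg m ^ (-1 : ℤ) * xg m := by
  rw [zpow_neg_one, eq_inv_mul_iff_mul_eq, ← xg_mul_self, mul_inv_cancel_right]

theorem yg_zpow_eq {A B : ℤ} (h : (A : ZMod m) = B) : ∃ q : ℤ, yg m ^ A = Δg m ^ q * yg m ^ B := by
  obtain ⟨q, hq⟩ := (ZMod.intCast_eq_intCast_iff_dvd_sub B A m).1 h.symm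
  refine ⟨q, ?_⟩
  rw [← yg_pow, ← zpow_natCast, ← zpow_mul, ← zpow_add, ← hq, sub_add_cancel]

/-- The product `∏ x yᵇ` over the entries `b` of `r`. -/
def blocks (r : List (ZMod m)) : TorusGrp m := (r.map fun b => xg m * yg m ^ b.valMinAbs).prod

/-- Normal forms modulo `Δ`: `(a, [b₁, …, bₛ])` stands for `yᵃ x yᵇ¹ ⋯ x yᵇˢ`. -/
abbrev NF (m : ℕ) : Type := ZMod m × {r : List (ZMod m) // ∀ a ∈ r.dropLast, a ≠ 0}

/-- Left multiplication by `x` on normal forms. -/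
def mulX : NF m → NF m
  | (a, ⟨[], _⟩) => (0, ⟨[a], by simp⟩)
  | (a, ⟨b :: r, h⟩) =>
    if ha : a = 0 then
      (b, ⟨r, fun c hc => h c (by cases r with
        | nil => simp at hc
        | cons d t => rw [dropLast_cons_cons]; exact mem_cons_of_mem _ hc)⟩)
    else (0, ⟨a :: b :: r, by
      intro c hc
      rw [dropLast_cons_cons, mem_cons] at hc
      rcases hc with rfl | hc
      exacts [ha, h c hc]⟩)

theorem mulX_mulX (w : NF m) : mulX (mulX w) = w := by
  rcases w with ⟨a, ⟨_ | ⟨b, r⟩, h⟩⟩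
  · simp [mulX]
  · by_cases ha : a = 0
    · subst ha
      rcases r with _ | ⟨c, r⟩
      · simp [mulX]
      · have hb : b ≠ 0 := h b (by simp)
        simp [mulX, hb]
    · simp [mulX, ha]

/-- The action of the generators on normal forms by left multiplication. -/
def nfGen (m : ℕ) : Bool → Equiv.Perm (NF m)
  | true => ⟨mulX, mulX, mulX_mulX, mulX_mulX⟩
  | false => (Equiv.addLeft 1).prodCongr (Equiv.refl _)

theorem nfGen_false_pow (k : ℕ) (w : NF m) : (nfGen m false ^ k) w = (k + w.1, w.2) := by
  induction k with
  | zero => simp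
  | succ k ih => rw [pow_succ', Equiv.Perm.mul_apply, ih]; simp [nfGen]; ring

theorem nfGen_true_sq : nfGen m true ^ 2 = 1 := by
  ext1 w
  exact mulX_mulX w

/-- The action of `⟨x, y ∣ x² = yᵐ⟩` on normal forms by left multiplication. -/
def nfHom (m : ℕ) : TorusGrp m →* Equiv.Perm (NF m) :=
  PresentedGroup.toGroup (f := nfGen m) (by
    rintro _ rfl
    rw [map_mul, map_inv, map_pow, map_pow, FreeGroup.lift_apply_of, FreeGroup.lift_apply_of,
      nfGen_true_sq, one_mul, inv_eq_one]
    ext1 w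
    simp [nfGen_false_pow])

theorem nfHom_x : nfHom m (xg m) = nfGen m true := PresentedGroup.toGroup.of _

theorem nfHom_y : nfHom m (yg m) = nfGen m false := PresentedGroup.toGroup.of _

theorem nfHom_Δ : nfHom m (Δg m) = 1 := by
  rw [Δg, map_pow, nfHom_x, nfGen_true_sq]

/-- The normal form of `g` modulo `Δ`. -/
def nf (g : TorusGrp m) : NF m := nfHom m g (0, ⟨[], by simp⟩)

theorem nf_Δg_zpow_mul (k : ℤ) (g : TorusGrp m) : nf (Δg m ^ k * g) = nf g := by
  simp [nf, nfHom_Δ]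

theorem nf_x_mul (g : TorusGrp m) : nf (xg m * g) = mulX (nf g) := by
  simp only [nf, map_mul, nfHom_x, Equiv.Perm.mul_apply]; rfl

theorem nf_x_inv_mul (g : TorusGrp m) : nf ((xg m)⁻¹ * g) = mulX (nf g) := by
  rw [xg_inv, mul_assoc, nf_Δg_zpow_mul, nf_x_mul]

theorem nf_y_mul (g : TorusGrp m) : nf (yg m * g) = (1 + (nf g).1, (nf g).2) := by
  simp only [nf, map_mul, nfHom_y, Equiv.Perm.mul_apply]; rfl

theorem nf_y_inv_mul (g : TorusGrp m) : nf ((yg m)⁻¹ * g) = (-1 + (nf g).1, (nf g).2) := by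
  have h := nf_y_mul ((yg m)⁻¹ * g)
  rw [mul_inv_cancel_left] at h
  rw [h]
  simp

theorem nf_y_zpow_mul (k : ℤ) (g : TorusGrp m) :
    nf (yg m ^ k * g) = (k + (nf g).1, (nf g).2) := by
  induction k with
  | zero => simp
  | succ k ih => rw [add_comm, zpow_one_add, mul_assoc, nf_y_mul, ih]; simp; ring
  | pred k ih =>
    rw [sub_eq_neg_add, zpow_add, zpow_neg_one, mul_assoc, nf_y_inv_mul, ih]; simp; ring

theorem nf_blocks (r : List (ZMod m)) (h : ∀ a ∈ r.dropLast, a ≠ 0) :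
    nf (blocks r) = (0, ⟨r, h⟩) := by
  induction r with
  | nil => simp [blocks, nf]
  | cons b r ih =>
    have h' : ∀ a ∈ r.dropLast, a ≠ 0 := fun c hc => h c (by
      cases r with
      | nil => simp at hc
      | cons d t => rw [dropLast_cons_cons]; exact mem_cons_of_mem _ hc)
    have : blocks (b :: r) = xg m * (yg m ^ b.valMinAbs * blocks r) := by simp [blocks, mul_assoc]
    rw [this, nf_x_mul, nf_y_zpow_mul, ih h']
    rcases r with _ | ⟨c, r⟩
    · simp [mulX]
    · have hb : b ≠ 0 := h b (by simp)
      simp [mulX, hb]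

/-- The normal form determines an element up to powers of `Δ`. -/
theorem exists_eq_nf (g : TorusGrp m) :
    ∃ k : ℤ, g = Δg m ^ k * (yg m ^ (nf g).1.valMinAbs * blocks (nf g).2.1) := by
  have hy : ∀ (e : ℤ) (g : TorusGrp m),
      (∃ k : ℤ, g = Δg m ^ k * (yg m ^ (nf g).1.valMinAbs * blocks (nf g).2.1)) →
      ∃ k : ℤ, yg m ^ e * g = Δg m ^ k *
        (yg m ^ (nf (yg m ^ e * g)).1.valMinAbs * blocks (nf (yg m ^ e * g)).2.1) := by
    rintro e g ⟨k, hk⟩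
    rw [nf_y_zpow_mul]
    obtain ⟨q, hq⟩ := yg_zpow_eq (m := m) (A := e + (nf g).1.valMinAbs)
      (B := ((e : ZMod m) + (nf g).1).valMinAbs) (by simp)
    refine ⟨k + q, ?_⟩
    conv_lhs => rw [hk]
    rw [mul_Δg_zpow_mul, ← mul_assoc (yg m ^ e), ← zpow_add, hq, zpow_add, mul_assoc, mul_assoc]
  have hx : ∀ g : TorusGrp m,
      (∃ k : ℤ, g = Δg m ^ k * (yg m ^ (nf g).1.valMinAbs * blocks (nf g).2.1)) →
      ∃ k : ℤ, xg m * g = Δg m ^ k *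
        (yg m ^ (nf (xg m * g)).1.valMinAbs * blocks (nf (xg m * g)).2.1) := by
    rintro g ⟨k, hk⟩
    rw [nf_x_mul]
    generalize nf g = w at hk
    subst hk
    rcases w with ⟨a, ⟨_ | ⟨b, r⟩, h⟩⟩
    · exact ⟨k, by rw [mul_Δg_zpow_mul]; simp [mulX, blocks]⟩
    · by_cases ha : a = 0
      · refine ⟨k + 1, ?_⟩
        rw [mul_Δg_zpow_mul]
        simp only [mulX, ha, dite_true, ZMod.valMinAbs_zero, zpow_zero, one_mul, zpow_add,
          zpow_one, blocks, map_cons, prod_cons, ← xg_mul_self, mul_assoc]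
      · exact ⟨k, by rw [mul_Δg_zpow_mul]; simp [mulX, blocks, ha, mul_assoc]⟩
  induction g using induction_left with
  | one => exact ⟨0, by simp [nf, blocks]⟩
  | mul a ha g ih =>
    rcases ha with rfl | rfl | rfl | rfl
    · exact hx g ih
    · obtain ⟨k, hk⟩ := hx g ih
      refine ⟨-1 + k, ?_⟩
      rw [nf_x_inv_mul, ← nf_x_mul, zpow_add, mul_assoc, ← hk, xg_inv, mul_assoc]
    · simpa using hy 1 g ih
    · simpa using hy (-1) g ih

end group

section len

variable {m : ℕ}

/-- The word length modulo `Δ`. -/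
def len (g : TorusGrp m) : ℕ :=
  nrm (nf g).1 + ((nf g).2.1.map fun b => nrm b + 1).sum

theorem inv_mem_genSet {a : TorusGrp m} (ha : a ∈ genSet m) : a⁻¹ ∈ genSet m := by
  rcases ha with rfl | rfl | rfl | rfl <;> simp [genSet]

theorem len_one : len (1 : TorusGrp m) = 0 := by simp [len, nf]

theorem len_Δg_zpow_mul (k : ℤ) (g : TorusGrp m) : len (Δg m ^ k * g) = len g := by
  rw [len, nf_Δg_zpow_mul, len]

theorem len_mul_le [NeZero m] {a : TorusGrp m} (ha : a ∈ genSet m) (g : TorusGrp m) :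
    len (a * g) ≤ len g + 1 := by
  have hx : len (xg m * g) ≤ len g + 1 := by
    rw [len, nf_x_mul, len]
    generalize nf g = w
    rcases w with ⟨a, ⟨_ | ⟨b, r⟩, h⟩⟩
    · simp [mulX]
    · by_cases ha : a = 0
      · simp only [mulX, ha, dite_true, map_cons, sum_cons, nrm_zero]
        omega
      · simp only [mulX, ha, dite_false, map_cons, sum_cons, nrm_zero]
        omega
  have h1 : nrm (1 : ZMod m) ≤ 1 := by simpa using nrm_cast_le (m := m) 1
  rcases ha with rfl | rfl | rfl | rfl
  · exact hx
  · rwa [xg_inv, mul_assoc, len_Δg_zpow_mul]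
  · rw [len, nf_y_mul, len]
    have := nrm_add_le 1 (nf g).1
    simp only
    omega
  · rw [len, nf_y_inv_mul, len]
    have := nrm_add_le (-1) (nf g).1
    rw [nrm_neg] at this
    simp only
    omega

theorem len_prod_le [NeZero m] {l : List (TorusGrp m)} (hl : ∀ a ∈ l, a ∈ genSet m) :
    len l.prod ≤ l.length := by
  induction l with
  | nil => simp [len_one]
  | cons a l ih =>
    have := ih fun b hb => hl b (mem_cons_of_mem _ hb)
    have := len_mul_le (hl a mem_cons_self) l.prod
    simp only [prod_cons, length_cons]
    omega

theorem blocks_append (r s : List (ZMod m)) : blocks (r ++ s) = blocks r * blocks s := by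
  simp [blocks]

/-- `g` equals `yᵃ (∏ x yᶜ) x yᵇ` modulo `Δ`, where `c` runs over the nonzero entries of `r`. -/
def Rep (g : TorusGrp m) (a : ZMod m) (r : List (ZMod m)) (b : ZMod m) : Prop :=
  (∀ c ∈ r, c ≠ 0) ∧ ∃ k A B : ℤ, (A : ZMod m) = a ∧ (B : ZMod m) = b ∧
    g = Δg m ^ k * (yg m ^ A * (blocks r * (xg m * yg m ^ B)))

theorem Rep.normalize {g : TorusGrp m} {a b : ZMod m} {r : List (ZMod m)} (h : Rep g a r b) :
    ∃ k : ℤ, g = Δg m ^ k * (yg m ^ a.valMinAbs * (blocks r * (xg m * yg m ^ b.valMinAbs))) := by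
  obtain ⟨-, k, A, B, rfl, rfl, rfl⟩ := h
  obtain ⟨q, hq⟩ := yg_zpow_eq (m := m) (A := A) (B := (A : ZMod m).valMinAbs) (by simp)
  obtain ⟨p, hp⟩ := yg_zpow_eq (m := m) (A := B) (B := (B : ZMod m).valMinAbs) (by simp)
  refine ⟨k + q + p, ?_⟩
  rw [hq, hp]
  simp only [mul_Δg_zpow_mul (xg m), mul_Δg_zpow_mul (blocks r), mul_assoc,
    zpow_add, mul_Δg_zpow_mul (yg m ^ (A : ZMod m).valMinAbs)]

theorem Rep.nf {g : TorusGrp m} {a b : ZMod m} {r : List (ZMod m)} (h : Rep g a r b) :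
    nf g = (a, ⟨r ++ [b], by simpa using h.1⟩) := by
  obtain ⟨k, hk⟩ := h.normalize
  have : blocks (r ++ [b]) = blocks r * (xg m * yg m ^ b.valMinAbs) := by
    rw [blocks_append]; simp [blocks]
  have hr : ∀ c ∈ (r ++ [b]).dropLast, c ≠ 0 := by simpa using h.1
  have hn : TorusKnot.nf g = (a, ⟨r ++ [b], hr⟩) := by
    rw [hk, nf_Δg_zpow_mul, ← this, nf_y_zpow_mul, nf_blocks _ hr]
    simp
  exact hn

theorem Rep.len {g : TorusGrp m} {a b : ZMod m} {r : List (ZMod m)} (h : Rep g a r b) :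
    len g = nrm a + (r.map fun c => nrm c + 1).sum + nrm b + 1 := by
  rw [TorusKnot.len, h.nf]
  simp
  omega

theorem zpow_or_rep (g : TorusGrp m) : (∃ e : ℤ, g = yg m ^ e) ∨ ∃ a r b, Rep g a r b := by
  obtain ⟨k, hk⟩ := exists_eq_nf g
  generalize nf g = w at hk
  rcases w with ⟨a, ⟨r, h⟩⟩
  rcases eq_nil_or_concat r with rfl | ⟨r, b, rfl⟩
  · left
    refine ⟨m * k + a.valMinAbs, ?_⟩
    rw [hk, ← yg_pow, zpow_add, zpow_mul, zpow_natCast]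
    simp [blocks]
  · right
    refine ⟨a, r, b, by simpa using h, k, a.valMinAbs, b.valMinAbs, by simp, by simp, ?_⟩
    rw [hk]
    simp [blocks]

theorem Rep.y_left {g : TorusGrp m} {a b : ZMod m} {r : List (ZMod m)} (h : Rep g a r b) (e : ℤ) :
    Rep (yg m ^ e * g) (a + e) r b := by
  obtain ⟨h, k, A, B, rfl, rfl, rfl⟩ := h
  refine ⟨h, k, e + A, B, by push_cast; ring, rfl, ?_⟩
  rw [mul_Δg_zpow_mul, zpow_add, mul_assoc]

theorem Rep.y_right {g : TorusGrp m} {a b : ZMod m} {r : List (ZMod m)} (h : Rep g a r b) (e : ℤ) :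
    Rep (g * yg m ^ e) a r (b + e) := by
  obtain ⟨h, k, A, B, rfl, rfl, rfl⟩ := h
  refine ⟨h, k, A, B + e, rfl, by push_cast; ring, ?_⟩
  simp only [zpow_add, mul_assoc]

theorem Rep.x_left {g : TorusGrp m} {a b : ZMod m} {r : List (ZMod m)} (h : Rep g a r b)
    (ha : a ≠ 0) : Rep (xg m * g) 0 (a :: r) b := by
  obtain ⟨k, hk⟩ := h.normalize
  refine ⟨by simpa [ha] using h.1, k, 0, b.valMinAbs, by simp, by simp, ?_⟩
  rw [hk, mul_Δg_zpow_mul]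
  simp [blocks, mul_assoc]

theorem Rep.x_right {g : TorusGrp m} {a b : ZMod m} {r : List (ZMod m)} (h : Rep g a r b)
    (hb : b ≠ 0) : Rep (g * xg m) a (r ++ [b]) 0 := by
  obtain ⟨k, hk⟩ := h.normalize
  refine ⟨?_, k, a.valMinAbs, 0, by simp, by simp, ?_⟩
  · intro c hc
    rcases mem_append.1 hc with hc | hc
    · exact h.1 c hc
    · rw [mem_singleton.1 hc]; exact hb
  · rw [hk, blocks_append]
    simp [blocks, mul_assoc]

theorem Rep.Δ_left {g : TorusGrp m} {a b : ZMod m} {r : List (ZMod m)} (h : Rep g a r b) (j : ℤ) :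
    Rep (Δg m ^ j * g) a r b := by
  obtain ⟨h, k, A, B, hA, hB, rfl⟩ := h
  exact ⟨h, j + k, A, B, hA, hB, by rw [zpow_add, mul_assoc]⟩

theorem len_x_left {g : TorusGrp m} {b : ZMod m} {r : List (ZMod m)} (h : Rep g 0 r b) :
    len (xg m * g) < len g := by
  have hn := h.nf
  rw [len, nf_x_mul, len, hn]
  rcases r with _ | ⟨c, r⟩ <;> simp [mulX]

theorem len_x_right {g : TorusGrp m} {a : ZMod m} {r : List (ZMod m)} (h : Rep g a r 0) :
    len (g * xg m) < len g := by
  have hl := h.len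
  obtain ⟨k, hk⟩ := h.normalize
  have hx : g * xg m = Δg m ^ (k + 1) * (yg m ^ a.valMinAbs * blocks r) := by
    rw [hk, zpow_add, zpow_one, ← xg_mul_self]
    have hc := mul_Δg_zpow (blocks r) 1
    rw [zpow_one, ← xg_mul_self] at hc
    have hc' := mul_Δg_zpow (yg m ^ a.valMinAbs) 1
    rw [zpow_one, ← xg_mul_self] at hc'
    simp only [ZMod.valMinAbs_zero, zpow_zero, mul_one, mul_assoc] at hc hc' ⊢
    rw [hc, ← mul_assoc (yg m ^ _) (xg m), ← mul_assoc (yg m ^ _ * _), mul_assoc (yg m ^ _), hc']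
    simp only [mul_assoc]
  rw [hx, len_Δg_zpow_mul, len, nf_y_zpow_mul,
    nf_blocks r fun c hc => h.1 c (mem_of_mem_dropLast hc)]
  simp only [add_zero, ZMod.coe_valMinAbs]
  omega

/-- Adding `1` and subtracting `1` cannot both decrease the distance to `0`. -/
theorem le_nrm_add (hodd : Odd m) (a : ZMod m) : nrm a ≤ nrm (a + 1) ∨ nrm a ≤ nrm (a - 1) := by
  by_contra! hcon
  have h0 := two_mul_nrm_lt hodd a
  have h1 := two_mul_nrm_lt hodd (a + 1)
  have h2 := two_mul_nrm_lt hodd (a - 1)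
  unfold nrm at *
  have e1 : (a + 1).valMinAbs - 1 = a.valMinAbs := by
    refine eq_of_cast_eq (m := m) (by simp) ?_
    omega
  have e2 : (a - 1).valMinAbs + 1 = a.valMinAbs := by
    refine eq_of_cast_eq (m := m) (by simp) ?_
    omega
  omega

/-- A letter is determined up to powers of `Δ` by the effect of its descent on the adjacent
exponent `c`. -/
theorem letter_unique (hodd : Odd m) {D : TorusGrp m → Prop} {c : ZMod m}
    (hx : D (xg m) → c = 0) (hx' : D (xg m)⁻¹ → c = 0) (hy : D (yg m) → nrm (c + 1) < nrm c)
    (hy' : D (yg m)⁻¹ → nrm (c - 1) < nrm c) {p q : TorusGrp m} (hp : p ∈ genSet m)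
    (hq : q ∈ genSet m) (hDp : D p) (hDq : D q) : ∃ e : ℤ, p = Δg m ^ e * q := by
  have h0 : c = 0 → nrm c = 0 := by rintro rfl; simp
  have hor := le_nrm_add hodd c
  have hi := xg_inv (m := m)
  have hi' : xg m = Δg m ^ (1 : ℤ) * (xg m)⁻¹ := by rw [hi, ← mul_assoc, ← zpow_add]; simp
  have h1 (p : TorusGrp m) : p = Δg m ^ (0 : ℤ) * p := by simp
  rcases hp with rfl | rfl | rfl | rfl <;> rcases hq with rfl | rfl | rfl | rfl
  all_goals first
    | exact ⟨_, h1 _⟩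
    | exact ⟨_, hi⟩
    | exact ⟨_, hi'⟩
    | (exfalso; grind)

/-- The first letter of a geodesic is determined up to powers of `Δ`. -/
theorem first_unique (hodd : Odd m) {g p q : TorusGrp m} {a b : ZMod m} {r : List (ZMod m)}
    (h : Rep g a r b) (hp : p ∈ genSet m) (hq : q ∈ genSet m) (hpg : len (p * g) < len g)
    (hqg : len (q * g) < len g) : ∃ e : ℤ, p = Δg m ^ e * q := by
  have hg := h.len
  have hy (e : ℤ) (he : len (yg m ^ e * g) < len g) : nrm (a + (e : ZMod m)) < nrm a := by
    have := (h.y_left e).len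
    omega
  have hx (hx : len (xg m * g) < len g) : a = 0 := by
    by_contra ha
    have := (h.x_left ha).len
    rw [map_cons, sum_cons, nrm_zero] at this
    omega
  refine letter_unique hodd (D := fun p => len (p * g) < len g) hx ?_ ?_ ?_ hp hq hpg hqg
  · rwa [xg_inv, mul_assoc, len_Δg_zpow_mul]
  · simpa using hy 1
  · simpa [sub_eq_add_neg] using hy (-1)

/-- The last letter of a geodesic is determined up to powers of `Δ`. -/
theorem last_unique (hodd : Odd m) {g p q : TorusGrp m} {a b : ZMod m} {r : List (ZMod m)}
    (h : Rep g a r b) (hp : p ∈ genSet m) (hq : q ∈ genSet m) (hpg : len (g * p) < len g)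
    (hqg : len (g * q) < len g) : ∃ e : ℤ, p = Δg m ^ e * q := by
  have hg := h.len
  have hy (e : ℤ) (he : len (g * yg m ^ e) < len g) : nrm (b + (e : ZMod m)) < nrm b := by
    have := (h.y_right e).len
    omega
  have hx (hx : len (g * xg m) < len g) : b = 0 := by
    by_contra hb
    have := (h.x_right hb).len
    rw [map_append, sum_append, map_singleton, sum_singleton, nrm_zero] at this
    omega
  refine letter_unique hodd (D := fun p => len (g * p) < len g) hx ?_ ?_ ?_ hp hq hpg hqg
  · rwa [xg_inv, mul_Δg_zpow_mul, len_Δg_zpow_mul]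
  · simpa using hy 1
  · simpa [sub_eq_add_neg] using hy (-1)

end len

section rotation

variable {G : Type*} [Group G]

/-- Twisted rotation of a word: the first letter moves to the end and is inverted. -/
def rot : List G → List G
  | [] => []
  | a :: l => l ++ [a⁻¹]

theorem rot_iterate_append (l l' : List G) : rot^[l.length] (l ++ l') = l' ++ l.map (·⁻¹) := by
  induction l generalizing l' with
  | nil => simp
  | cons a l ih =>
    rw [length_cons, Function.iterate_succ_apply, cons_append, rot, append_assoc, ih]
    simp

theorem rot_iterate_two_mul_length (l : List G) : rot^[2 * l.length] l = l := by
  have h (l : List G) : rot^[l.length] l = l.map (·⁻¹) := by simpa using rot_iterate_append l []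
  rw [two_mul, Function.iterate_add_apply, h]
  have := h (l.map (·⁻¹))
  rw [length_map] at this
  rw [this]
  simp

theorem length_rot (l : List G) : (rot l).length = l.length := by
  cases l <;> simp [rot]

end rotation

section minimal

variable {m : ℕ}

/-- A union `C` of `φ`-twisted conjugacy classes which contains no power of `y` and whose elements
have length at least `n ≥ 2` modulo `Δ`. -/
structure IsMinClass (C : Set (TorusGrp m)) (n : ℕ) : Prop where
  conj_mem : ∀ a ∈ genSet m, ∀ h ∈ C, a * h * a ∈ C
  le_len : ∀ h ∈ C, n ≤ len h
  two_le : 2 ≤ n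
  zpow_notMem : ∀ e : ℤ, yg m ^ e ∉ C

theorem conj_y_mem {C : Set (TorusGrp m)} (hC : ∀ a ∈ genSet m, ∀ h ∈ C, a * h * a ∈ C)
    {h : TorusGrp m} (hh : h ∈ C) (e : ℤ) : yg m ^ e * h * yg m ^ e ∈ C := by
  induction e with
  | zero => simpa using hh
  | succ e ih =>
    have := hC (yg m) (by simp [genSet]) _ ih
    convert this using 1
    calc yg m ^ ((e : ℤ) + 1) * h * yg m ^ ((e : ℤ) + 1)
        = yg m ^ (1 + (e : ℤ)) * h * yg m ^ ((e : ℤ) + 1) := by rw [add_comm]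
      _ = _ := by rw [zpow_one_add, zpow_add_one]; simp only [mul_assoc]
  | pred e ih =>
    have := hC (yg m)⁻¹ (by simp [genSet]) _ ih
    convert this using 1
    calc yg m ^ (-(e : ℤ) - 1) * h * yg m ^ (-(e : ℤ) - 1)
        = yg m ^ (-1 + -(e : ℤ)) * h * yg m ^ (-(e : ℤ) - 1) := by rw [neg_add_eq_sub]
      _ = _ := by rw [zpow_add, zpow_neg_one, zpow_sub_one]; simp only [mul_assoc]

theorem Δg_mul_mem {C : Set (TorusGrp m)} (hC : ∀ a ∈ genSet m, ∀ h ∈ C, a * h * a ∈ C)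
    {h : TorusGrp m} (hh : h ∈ C) (k : ℤ) : Δg m ^ (2 * k) * h ∈ C := by
  have := conj_y_mem hC hh (m * k)
  rw [zpow_mul, zpow_natCast, yg_pow, mul_Δg_zpow, ← mul_assoc, ← zpow_add] at this
  rwa [two_mul]

/-- The words over `genSet m` of length `n` whose product is in `C`. -/
def IsMinWord (C : Set (TorusGrp m)) (n : ℕ) (l : List (TorusGrp m)) : Prop :=
  (∀ a ∈ l, a ∈ genSet m) ∧ l.length = n ∧ l.prod ∈ C

/-- The products of the rotations of the word `w`, up to powers of `Δ²`. -/
def rotations (w : List (TorusGrp m)) : Set (TorusGrp m) :=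
  {g | ∃ (k : ℤ) (j : ℕ), g = Δg m ^ (2 * k) * (rot^[j] w).prod}

variable {C : Set (TorusGrp m)} {n : ℕ} {w : List (TorusGrp m)}

theorem prod_rot_cons (a : TorusGrp m) (l : List (TorusGrp m)) :
    (rot (a :: l)).prod = a⁻¹ * (a :: l).prod * a⁻¹ := by
  simp [rot]

theorem IsMinClass.rot_iterate (hC : IsMinClass C n) (hw : IsMinWord C n w) (j : ℕ) :
    IsMinWord C n (rot^[j] w) := by
  induction j with
  | zero => exact hw
  | succ j ih =>
    rw [Function.iterate_succ_apply']
    obtain ⟨h1, h2, h3⟩ := ih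
    generalize rot^[j] w = l at h1 h2 h3
    cases l with
    | nil => exact ⟨h1, h2, h3⟩
    | cons a l =>
      have ha := inv_mem_genSet (h1 a mem_cons_self)
      refine ⟨?_, by rw [length_rot, h2], ?_⟩
      · intro b hb
        rw [rot, mem_append, mem_singleton] at hb
        rcases hb with hb | rfl
        exacts [h1 b (mem_cons_of_mem _ hb), ha]
      · rw [prod_rot_cons]
        exact hC.conj_mem _ ha _ h3

theorem Δg_mul_mem_rotations {r : TorusGrp m} (hr : r ∈ rotations w) (k : ℤ) :
    Δg m ^ (2 * k) * r ∈ rotations w := by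
  obtain ⟨k', j, rfl⟩ := hr
  exact ⟨k + k', j, by rw [← mul_assoc, ← zpow_add, mul_add]⟩

theorem IsMinClass.mem_of_rotations (hC : IsMinClass C n) (hw : IsMinWord C n w) {r : TorusGrp m}
    (hr : r ∈ rotations w) : r ∈ C := by
  obtain ⟨k, j, rfl⟩ := hr
  exact Δg_mul_mem hC.conj_mem (hC.rot_iterate hw j).2.2 k

theorem IsMinClass.len_of_rotations [NeZero m] (hC : IsMinClass C n) (hw : IsMinWord C n w)
    {r : TorusGrp m} (hr : r ∈ rotations w) : len r = n := by
  refine le_antisymm ?_ (hC.le_len r (hC.mem_of_rotations hw hr))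
  obtain ⟨k, j, rfl⟩ := hr
  have h := hC.rot_iterate hw j
  rw [len_Δg_zpow_mul]
  exact (len_prod_le h.1).trans h.2.1.le

theorem conj_eq {p q r : TorusGrp m} {e : ℤ} (h : p = Δg m ^ e * q) :
    p * r * p = Δg m ^ (2 * e) * (q * r * q) := by
  rw [h, mul_Δg_zpow_mul, two_mul, zpow_add]
  simp only [mul_assoc]

theorem IsMinClass.conj_left [NeZero m] (hodd : Odd m) (hC : IsMinClass C n)
    (hw : IsMinWord C n w) {r p : TorusGrp m} (hr : r ∈ rotations w) {a b : ZMod m}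
    {s : List (ZMod m)} (hs : Rep r a s b) (hp : p ∈ genSet m) (hlt : len (p * r) < len r) :
    p * r * p ∈ rotations w := by
  have hlen := hC.len_of_rotations hw hr
  obtain ⟨k, j, hk⟩ := hr
  have h := hC.rot_iterate hw j
  rcases hl : rot^[j] w with _ | ⟨c, l⟩
  · have := h.2.1
    have := hC.two_le
    simp only [hl, length_nil] at *
    omega
  · rw [hl] at h hk
    have hc := inv_mem_genSet (h.1 c mem_cons_self)
    have hlt' : len (c⁻¹ * r) < len r := by
      have := h.2.1
      have := len_prod_le fun d hd => h.1 d (mem_cons_of_mem c hd)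
      rw [hlen, hk, mul_Δg_zpow_mul, len_Δg_zpow_mul, prod_cons, inv_mul_cancel_left]
      rw [length_cons] at *
      omega
    obtain ⟨e, he⟩ := first_unique hodd hs hp hc hlt hlt'
    rw [conj_eq he]
    refine Δg_mul_mem_rotations ⟨k, j + 1, ?_⟩ _
    rw [Function.iterate_succ_apply', hl, prod_rot_cons, hk, mul_Δg_zpow_mul, mul_assoc]

theorem IsMinClass.conj_right [NeZero m] (hodd : Odd m) (hC : IsMinClass C n)
    (hw : IsMinWord C n w) {r p : TorusGrp m} (hr : r ∈ rotations w) {a b : ZMod m}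
    {s : List (ZMod m)} (hs : Rep r a s b) (hp : p ∈ genSet m) (hlt : len (r * p) < len r) :
    p * r * p ∈ rotations w := by
  have hlen := hC.len_of_rotations hw hr
  obtain ⟨k, j, hk⟩ := hr
  have h := hC.rot_iterate hw j
  rcases eq_nil_or_concat (rot^[j] w) with hl | ⟨l, c, hl⟩
  · have := h.2.1
    have := hC.two_le
    simp only [hl, length_nil] at *
    omega
  · rw [concat_eq_append] at hl
    rw [hl] at h hk
    have hc := inv_mem_genSet (h.1 c (by simp))
    have hlt' : len (r * c⁻¹) < len r := by
      have := h.2.1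
      have := len_prod_le fun d hd => h.1 d (mem_append_left [c] hd)
      rw [hlen, hk, mul_assoc, len_Δg_zpow_mul, prod_append, prod_singleton, mul_inv_cancel_right]
      rw [length_append, length_singleton] at *
      omega
    obtain ⟨e, he⟩ := last_unique hodd hs hp hc hlt hlt'
    rw [conj_eq he]
    refine Δg_mul_mem_rotations ⟨k, 2 * n - 1 + j, ?_⟩ _
    have hrot : l ++ [c] = rot (c⁻¹ :: l) := by simp [rot]
    have hn := hC.two_le
    have hlen' : (c⁻¹ :: l).length = n := by simpa using h.2.1
    rw [Function.iterate_add_apply, hl, hrot, ← Function.iterate_succ_apply,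
      show (2 * n - 1).succ = 2 * (c⁻¹ :: l).length by omega, rot_iterate_two_mul_length, hk]
    simp [mul_assoc, mul_Δg_zpow_mul]

theorem Rep.y_conj {g : TorusGrp m} {a b : ZMod m} {r : List (ZMod m)} (h : Rep g a r b) (e : ℤ) :
    Rep (yg m ^ e * g * yg m ^ e) (a + e) r (b + e) :=
  (h.y_left e).y_right e

theorem IsMinClass.exists_rep (hC : IsMinClass C n) {h : TorusGrp m} (hh : h ∈ C) :
    ∃ a s b, Rep h a s b :=
  (zpow_or_rep h).resolve_left fun ⟨e, he⟩ => hC.zpow_notMem e (he ▸ hh)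

theorem IsMinClass.nrm_add_nrm_le (hC : IsMinClass C n) {h : TorusGrp m} (hh : h ∈ C)
    (hn : TorusKnot.len h = n) {a b : ZMod m} {s : List (ZMod m)} (hs : Rep h a s b) (e : ℤ) :
    nrm a + nrm b ≤ nrm (a + (e : ZMod m)) + nrm (b + (e : ZMod m)) := by
  have h1 := hC.le_len _ (conj_y_mem hC.conj_mem hh e)
  rw [(hs.y_conj e).len] at h1
  rw [hs.len] at hn
  omega

theorem exists_valMinAbs_add (a : ZMod m) (e : ℤ) :
    ∃ k : ℤ, (a + (e : ZMod m)).valMinAbs = a.valMinAbs + e + m * k := by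
  obtain ⟨k, hk⟩ := (ZMod.intCast_eq_intCast_iff_dvd_sub (a.valMinAbs + e)
    (a + (e : ZMod m)).valMinAbs m).1 (by simp)
  exact ⟨k, by omega⟩

theorem shift_eq_zero {A B A' B' e k l : ℤ} (hA : A' = A + e + m * k) (hB : B' = B + e + m * l)
    (h : A.natAbs + B.natAbs + (A'.natAbs + B'.natAbs) < m) (he : 2 * e.natAbs < m) :
    k = 0 ∧ l = 0 := by
  have hzero (c : ℤ) (hc : (m * c).natAbs < m) : c = 0 := by
    rw [Int.natAbs_mul, Int.natAbs_natCast, mul_comm] at hc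
    have := Nat.lt_of_mul_lt_mul_right (hc.trans_eq (one_mul m).symm)
    omega
  have hAA := Int.natAbs_sub_le A' A
  have hBB := Int.natAbs_sub_le B' B
  have hkl : k - l = 0 := hzero _ (by
    rw [show m * (k - l) = A' - A - (B' - B) by linarith]
    have := Int.natAbs_sub_le (A' - A) (B' - B)
    omega)
  obtain rfl : k = l := by omega
  have h2 : (2 * (m * k)).natAbs < 2 * m := by
    rw [show 2 * (m * k) = A' - A + (B' - B) - 2 * e by linarith]
    have := Int.natAbs_sub_le (A' - A + (B' - B)) (2 * e)
    have := Int.natAbs_add_le (A' - A) (B' - B)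
    have : (2 * e).natAbs = 2 * e.natAbs := Int.natAbs_mul 2 e
    omega
  have h3 : (2 * (m * k)).natAbs = 2 * (m * k).natAbs := Int.natAbs_mul 2 _
  have := hzero k (by omega)
  exact ⟨this, this⟩

/-- Powers of `y` which preserve the length act on the rotations. -/
theorem IsMinClass.y_conj_mem_rotations [NeZero m] (hodd : Odd m) (hC : IsMinClass C n)
    (hw : IsMinWord C n w) {s : List (ZMod m)} (N : ℕ) :
    ∀ {e : ℤ} {r : TorusGrp m} {a b : ZMod m}, e.natAbs = N → 2 * e.natAbs < m →
      r ∈ rotations w → Rep r a s b →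
      nrm (a + (e : ZMod m)) + nrm (b + (e : ZMod m)) = nrm a + nrm b →
      yg m ^ e * r * yg m ^ e ∈ rotations w := by
  induction N with
  | zero =>
    intro e r a b he _ hr _ _
    rw [Int.natAbs_eq_zero.1 he]
    simpa using hr
  | succ N ih =>
    intro e r a b he hem hr hs hab
    have step (d : ℤ) (hd : d = 1 ∨ d = -1) (hed : (e - d).natAbs = N)
        (hlt : nrm (a + (d : ZMod m)) < nrm a ∨ nrm (b + (d : ZMod m)) < nrm b) :
        yg m ^ e * r * yg m ^ e ∈ rotations w := by
      have hdm : yg m ^ d ∈ genSet m := by rcases hd with rfl | rfl <;> simp [genSet]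
      have hr' : yg m ^ d * r * yg m ^ d ∈ rotations w := by
        have h1 := hs.len
        rcases hlt with hlt | hlt
        · refine hC.conj_left hodd hw hr hs hdm ?_
          rw [(hs.y_left d).len]
          omega
        · refine hC.conj_right hodd hw hr hs hdm ?_
          rw [(hs.y_right d).len]
          omega
      have hs' := hs.y_conj d
      have hl := hC.len_of_rotations hw hr
      have hl' := hC.len_of_rotations hw hr'
      rw [hs.len] at hl
      rw [hs'.len] at hl'
      have := ih hed (by omega) hr' hs' (by push_cast; simp only [add_add_sub_cancel]; omega)
      convert this using 1
      simp only [← mul_assoc, ← zpow_add, sub_add_cancel]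
      simp only [mul_assoc, ← zpow_add, add_sub_cancel]
    have hmin := hC.nrm_add_nrm_le (hC.mem_of_rotations hw hr) (hC.len_of_rotations hw hr) hs
      (-a.valMinAbs)
    have hba := two_mul_nrm_lt hodd (b + ((-a.valMinAbs : ℤ) : ZMod m))
    simp only [Int.cast_neg, ZMod.coe_valMinAbs, add_neg_cancel, nrm_zero] at hmin hba
    obtain ⟨k, hk⟩ := exists_valMinAbs_add a e
    obtain ⟨l, hl⟩ := exists_valMinAbs_add b e
    have hstep (c : ZMod m) (d : ℤ) (hd : d = 1 ∨ d = -1) (hc : c.valMinAbs * d < 0) :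
        nrm (c + (d : ZMod m)) < nrm c := by
      have := nrm_cast_le (m := m) (c.valMinAbs + d)
      rw [Int.cast_add, ZMod.coe_valMinAbs] at this
      rw [nrm] at this ⊢
      rw [nrm]
      rcases hd with rfl | rfl <;> omega
    unfold nrm at hab hmin hba
    obtain ⟨rfl, rfl⟩ := shift_eq_zero hk hl (by omega) hem
    rw [mul_zero, add_zero] at hk hl
    rcases lt_or_gt_of_ne (show e ≠ 0 by omega) with he0 | he0
    · have : a.valMinAbs * -1 < 0 ∨ b.valMinAbs * -1 < 0 := by omega
      exact step (-1) (by simp) (by omega) (this.imp (hstep a _ (by simp)) (hstep b _ (by simp)))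
    · have : a.valMinAbs * 1 < 0 ∨ b.valMinAbs * 1 < 0 := by omega
      exact step 1 (by simp) (by omega) (this.imp (hstep a _ (by simp)) (hstep b _ (by simp)))

theorem IsMinClass.zpow_conj_mem_rotations [NeZero m] (hodd : Odd m) (hC : IsMinClass C n)
    (hw : IsMinWord C n w) {r : TorusGrp m} (hr : r ∈ rotations w) {a b : ZMod m}
    {s : List (ZMod m)} (hs : Rep r a s b) {e : ℤ}
    (h : nrm (a + (e : ZMod m)) + nrm (b + (e : ZMod m)) = nrm a + nrm b) :
    yg m ^ e * r * yg m ^ e ∈ rotations w := by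
  obtain ⟨q, hq⟩ := yg_zpow_eq (m := m) (A := e) (B := (e : ZMod m).valMinAbs) (by simp)
  rw [conj_eq hq]
  exact Δg_mul_mem_rotations (hC.y_conj_mem_rotations hodd hw _ rfl
    (two_mul_nrm_lt hodd (e : ZMod m)) hr hs (by simpa using h)) _

/-- The elements obtained from rotations of `w` by twisted conjugation, each step lengthening. -/
inductive Tower (w : List (TorusGrp m)) : TorusGrp m → Prop
  | base (e : ℤ) {r : TorusGrp m} (hr : r ∈ rotations w) : Tower w (yg m ^ e * r * yg m ^ e)
  | up (k e : ℤ) {g : TorusGrp m} {a b : ZMod m} {s : List (ZMod m)} (hg : Tower w g)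
      (hs : Rep g a s b) (ha : a ≠ 0) (hb : b ≠ 0) :
      Tower w (Δg m ^ (2 * k) * (yg m ^ e * (xg m * g * xg m) * yg m ^ e))

theorem Tower.mem (hC : IsMinClass C n) (hw : IsMinWord C n w) {g : TorusGrp m}
    (hg : Tower w g) : g ∈ C := by
  induction hg with
  | base e hr => exact conj_y_mem hC.conj_mem (hC.mem_of_rotations hw hr) e
  | up k e _ _ _ _ ih =>
    exact Δg_mul_mem hC.conj_mem
      (conj_y_mem hC.conj_mem (hC.conj_mem _ (by simp [genSet]) _ ih) e) k

theorem Rep.x_conj {g : TorusGrp m} {a b : ZMod m} {s : List (ZMod m)} (hs : Rep g a s b)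
    (ha : a ≠ 0) (hb : b ≠ 0) : Rep (xg m * g * xg m) 0 (a :: s ++ [b]) 0 :=
  (hs.x_left ha).x_right hb

theorem Tower.mem_rotations [NeZero m] (hodd : Odd m) (hC : IsMinClass C n)
    (hw : IsMinWord C n w) {g : TorusGrp m} (hg : Tower w g) (hn : TorusKnot.len g = n) :
    g ∈ rotations w := by
  cases hg with
  | base e hr =>
    obtain ⟨a, s, b, hs⟩ := hC.exists_rep (hC.mem_of_rotations hw hr)
    refine hC.zpow_conj_mem_rotations hodd hw hr hs ?_
    have h1 := hC.len_of_rotations hw hr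
    rw [hs.len] at h1
    rw [(hs.y_conj e).len] at hn
    omega
  | up k e hg hs ha hb =>
    have h1 := hC.le_len _ (hg.mem hC hw)
    rw [hs.len] at h1
    rw [len_Δg_zpow_mul, ((hs.x_conj ha hb).y_conj e).len] at hn
    simp only [cons_append, map_cons, map_append, map_nil, sum_cons, sum_append, sum_nil] at hn
    omega

theorem Tower.Δ_mul {g : TorusGrp m} (hg : Tower w g) (j : ℤ) : Tower w (Δg m ^ (2 * j) * g) := by
  cases hg with
  | base e hr =>
    convert Tower.base e (Δg_mul_mem_rotations hr j) using 1
    simp only [mul_assoc, mul_Δg_zpow_mul]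
  | up k e hg hs ha hb =>
    convert Tower.up (j + k) e hg hs ha hb using 1
    rw [mul_add, zpow_add, mul_assoc (Δg m ^ (2 * j))]

theorem zpow_conj_conj (g : TorusGrp m) (f e : ℤ) :
    yg m ^ f * (yg m ^ e * g * yg m ^ e) * yg m ^ f = yg m ^ (f + e) * g * yg m ^ (f + e) := by
  calc _ = yg m ^ f * yg m ^ e * g * (yg m ^ e * yg m ^ f) := by simp only [mul_assoc]
    _ = _ := by rw [← zpow_add, ← zpow_add, add_comm e]

theorem Tower.y_conj {g : TorusGrp m} (hg : Tower w g) (f : ℤ) :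
    Tower w (yg m ^ f * g * yg m ^ f) := by
  cases hg with
  | base e hr =>
    rw [zpow_conj_conj]
    exact Tower.base (f + e) hr
  | up k e hg hs ha hb =>
    rw [mul_Δg_zpow_mul, mul_assoc, zpow_conj_conj]
    exact Tower.up k (f + e) hg hs ha hb

theorem Tower.x_conj [NeZero m] (hodd : Odd m) (hC : IsMinClass C n) (hw : IsMinWord C n w)
    {g : TorusGrp m} (hg : Tower w g) : Tower w (xg m * g * xg m) := by
  cases hg with
  | @base e r hr =>
    have hrC := hC.mem_of_rotations hw hr
    have hrn := hC.len_of_rotations hw hr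
    obtain ⟨a, s, b, hs⟩ := hC.exists_rep hrC
    have hmin := hC.nrm_add_nrm_le hrC hrn hs e
    have hs' := hs.y_conj e
    have of_mem (hx : yg m ^ e * r * yg m ^ e ∈ rotations w →
        xg m * (yg m ^ e * r * yg m ^ e) * xg m ∈ rotations w)
        (h : nrm (a + (e : ZMod m)) + nrm (b + (e : ZMod m)) ≤ nrm a + nrm b) :
        Tower w (xg m * (yg m ^ e * r * yg m ^ e) * xg m) := by
      have := hx (hC.zpow_conj_mem_rotations hodd hw hr hs (le_antisymm h hmin))
      simpa using Tower.base 0 this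
    have hxg : xg m ∈ genSet m := by simp [genSet]
    have htri := nrm_add_le b (-a)
    rw [nrm_neg] at htri
    by_cases ha : a + e = 0
    · rw [ha] at hs'
      refine of_mem (fun h => hC.conj_left hodd hw h hs' hxg (len_x_left hs')) ?_
      rw [ha, eq_neg_of_add_eq_zero_right ha, nrm_zero]
      omega
    by_cases hb : b + e = 0
    · rw [hb] at hs'
      refine of_mem (fun h => hC.conj_right hodd hw h hs' hxg (len_x_right hs')) ?_
      rw [hb, eq_neg_of_add_eq_zero_right hb, nrm_zero, ← nrm_neg, neg_add_rev, neg_neg]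
      omega
    simpa using Tower.up 0 0 (Tower.base e hr) hs' ha hb
  | @up k e g a b s hg hs ha hb =>
    by_cases he : (e : ZMod m) = 0
    · obtain ⟨q, hq⟩ := yg_zpow_eq (m := m) (A := e) (B := 0) (by simpa using he)
      rw [conj_eq hq]
      convert hg.Δ_mul (k + q + 1) using 1
      have hx : xg m * xg m = Δg m ^ (1 : ℤ) := by rw [xg_mul_self, zpow_one]
      have h1 : xg m * (xg m * g * xg m) * xg m = Δg m ^ (2 : ℤ) * g := by
        rw [show xg m * (xg m * g * xg m) * xg m = xg m * xg m * g * (xg m * xg m) by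
          simp only [mul_assoc], hx, mul_Δg_zpow, ← mul_assoc, ← zpow_add]
        rfl
      rw [zpow_zero, one_mul, mul_one]
      rw [mul_Δg_zpow_mul, mul_Δg_zpow_mul, mul_assoc, mul_assoc, h1, ← mul_assoc, ← mul_assoc,
        ← zpow_add, ← zpow_add]
      congr 2
      ring
    · have hs' := ((hs.x_conj ha hb).y_conj e).Δ_left (2 * k)
      rw [zero_add] at hs'
      simpa using Tower.up 0 0 (Tower.up k e hg hs ha hb) hs' he he

theorem Tower.conj_mem [NeZero m] (hodd : Odd m) (hC : IsMinClass C n) (hw : IsMinWord C n w)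
    {g : TorusGrp m} (hg : Tower w g) {a : TorusGrp m} (ha : a ∈ genSet m) :
    Tower w (a * g * a) := by
  rcases ha with rfl | rfl | rfl | rfl
  · exact hg.x_conj hodd hC hw
  · rw [conj_eq xg_inv]
    exact (hg.x_conj hodd hC hw).Δ_mul (-1)
  · simpa using hg.y_conj 1
  · simpa using hg.y_conj (-1)

end minimal

section spelling

variable {m : ℕ}

/-- `g` is a product of `k` generators. -/
def Spelled (g : TorusGrp m) (k : ℕ) : Prop :=
  ∃ l : List (TorusGrp m), l.length = k ∧ (∀ a ∈ l, a ∈ genSet m) ∧ l.prod = g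

theorem Spelled.mul {g h : TorusGrp m} {k l : ℕ} (hg : Spelled g k) (hh : Spelled h l) :
    Spelled (g * h) (k + l) := by
  obtain ⟨u, rfl, hu, rfl⟩ := hg
  obtain ⟨v, rfl, hv, rfl⟩ := hh
  exact ⟨u ++ v, length_append, fun a ha => (mem_append.1 ha).elim (hu a) (hv a), prod_append⟩

theorem spelled_of_mem {a : TorusGrp m} (ha : a ∈ genSet m) : Spelled a 1 :=
  ⟨[a], rfl, by simpa using ha, by simp⟩

theorem spelled_one : Spelled (1 : TorusGrp m) 0 := ⟨[], rfl, by simp, rfl⟩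

theorem spelled_y_zpow (e : ℤ) : Spelled (yg m ^ e) e.natAbs := by
  have hpow (a : TorusGrp m) (ha : a ∈ genSet m) (k : ℕ) : Spelled (a ^ k) k :=
    ⟨replicate k a, by simp, fun b hb => eq_of_mem_replicate hb ▸ ha, by simp⟩
  obtain ⟨k, rfl | rfl⟩ := e.eq_nat_or_neg
  · simpa using hpow (yg m) (by simp [genSet]) k
  · simpa using hpow (yg m)⁻¹ (by simp [genSet]) k

theorem spelled_blocks (r : List (ZMod m)) :
    Spelled (blocks r) (r.map fun c => nrm c + 1).sum := by
  induction r with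
  | nil => exact spelled_one
  | cons c r ih =>
    have h := ((spelled_of_mem (m := m) (a := xg m) (by simp [genSet])).mul
      (spelled_y_zpow c.valMinAbs)).mul ih
    rw [add_comm 1] at h
    simpa [blocks, nrm] using h

theorem Rep.exists_spelled {h : TorusGrp m} {a b : ZMod m} {s : List (ZMod m)}
    (hs : Rep h a s b) : ∃ k : ℤ, Spelled (Δg m ^ (2 * k) * h) (TorusKnot.len h) := by
  have hspell (p : TorusGrp m) (hp : p ∈ genSet m) :
      Spelled (yg m ^ a.valMinAbs * (blocks s * (p * yg m ^ b.valMinAbs)))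
        (TorusKnot.len h) := by
    have := (spelled_y_zpow a.valMinAbs).mul ((spelled_blocks s).mul
      ((spelled_of_mem hp).mul (spelled_y_zpow b.valMinAbs)))
    convert this using 1
    rw [hs.len, nrm, nrm]
    omega
  obtain ⟨k, hk⟩ := hs.normalize
  obtain ⟨j, rfl | rfl⟩ := k.even_or_odd'
  · refine ⟨-j, ?_⟩
    convert hspell (xg m) (by simp [genSet]) using 1
    rw [hk, ← mul_assoc, ← zpow_add, mul_neg, neg_add_cancel, zpow_zero, one_mul]
  · refine ⟨-j - 1, ?_⟩
    convert hspell (xg m)⁻¹ (by simp [genSet]) using 1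
    have hj : 2 * (-j - 1) + (2 * j + 1) = -1 := by ring
    rw [xg_inv, mul_assoc (Δg m ^ (-1 : ℤ)), mul_Δg_zpow_mul (blocks s),
      mul_Δg_zpow_mul (yg m ^ _), hk, ← mul_assoc, ← zpow_add, hj]

theorem Spelled.wordLen_le {g : TorusGrp m} {k : ℕ} (h : Spelled g k) : wordLen m g ≤ k :=
  Nat.sInf_le h

theorem spelled_wordLen {g : TorusGrp m} (h : 0 < wordLen m g) : Spelled g (wordLen m g) :=
  Nat.sInf_mem (Nat.nonempty_of_pos_sInf h)

end spelling

section abelianization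

variable {m : ℕ}

/-- The abelianization `x ↦ m`, `y ↦ 2`. -/
def ab (m : ℕ) : TorusGrp m →* Multiplicative ℤ :=
  PresentedGroup.toGroup (f := fun i => Multiplicative.ofAdd (if i then (m : ℤ) else 2)) (by
    rintro _ rfl
    rw [map_mul, map_inv, map_pow, map_pow, FreeGroup.lift_apply_of, FreeGroup.lift_apply_of,
      mul_inv_eq_one, ← ofAdd_nsmul, ← ofAdd_nsmul]
    simp [mul_comm])

/-- The additive exponent of `g` under the abelianization. -/
def deg (g : TorusGrp m) : ℤ := (ab m g).toAdd

theorem deg_mul (g h : TorusGrp m) : deg (g * h) = deg g + deg h := by simp [deg]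

theorem deg_inv (g : TorusGrp m) : deg g⁻¹ = -deg g := by simp [deg]

theorem deg_x : deg (xg m) = m := by
  simp only [deg, ab, xg, PresentedGroup.toGroup.of]; rfl

theorem deg_y : deg (yg m) = 2 := by
  simp only [deg, ab, yg, PresentedGroup.toGroup.of]; rfl

theorem deg_Δ_zpow (k : ℤ) : deg (Δg m ^ k) = 2 * m * k := by
  have : deg (Δg m) = 2 * m := by rw [← xg_mul_self, deg_mul, deg_x, two_mul]
  rw [deg] at this ⊢
  rw [map_zpow, toAdd_zpow, this, smul_eq_mul, mul_comm]

theorem len_x_zpow_le [NeZero m] (i : ℤ) : len (xg m ^ i) ≤ 1 := by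
  obtain ⟨j, rfl | rfl⟩ := i.even_or_odd'
  · have := len_Δg_zpow_mul j (1 : TorusGrp m)
    rw [zpow_mul, zpow_ofNat, ← Δg, ← mul_one (Δg m ^ j), this, len_one]
    exact zero_le_one
  · rw [zpow_add, zpow_mul, zpow_ofNat, ← Δg, zpow_one, len_Δg_zpow_mul]
    simpa [len_one] using len_mul_le (m := m) (a := xg m) (by simp [genSet]) 1

theorem deg_prod_lt_or (hm : 3 ≤ m) {l : List (TorusGrp m)} (hl : ∀ a ∈ l, a ∈ genSet m) :
    (deg l.prod).natAbs < m * l.length ∨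
      (deg l.prod).natAbs = m * l.length ∧ ∃ i : ℤ, l.prod = xg m ^ i := by
  induction l with
  | nil => exact Or.inr ⟨by simp [deg], 0, by simp⟩
  | cons a l ih =>
    have ih := ih fun b hb => hl b (mem_cons_of_mem _ hb)
    have ha := hl a mem_cons_self
    rw [prod_cons, deg_mul, length_cons, mul_add_one]
    have h := Int.natAbs_add_le (deg a) (deg l.prod)
    rcases ha with rfl | rfl | rfl | rfl
    · rw [deg_x] at *
      rcases ih with ih | ⟨ih, i, hi⟩
      · omega
      · have : xg m * l.prod = xg m ^ (1 + i) := by rw [hi, zpow_one_add]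
        by_cases hlt : ((m : ℤ) + deg l.prod).natAbs < m * l.length + m
        · exact Or.inl hlt
        · exact Or.inr ⟨by omega, _, this⟩
    · rw [deg_inv, deg_x] at *
      rcases ih with ih | ⟨ih, i, hi⟩
      · omega
      · have : (xg m)⁻¹ * l.prod = xg m ^ (-1 + i) := by rw [hi, zpow_add, zpow_neg_one]
        by_cases hlt : (-(m : ℤ) + deg l.prod).natAbs < m * l.length + m
        · exact Or.inl hlt
        · exact Or.inr ⟨by omega, _, this⟩
    · rw [deg_y] at *
      omega
    · rw [deg_inv, deg_y] at *
      omega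

theorem deg_natAbs_lt (hm : 3 ≤ m) {g : TorusGrp m} {n : ℕ} (hg : Spelled g n)
    (h : 2 ≤ len g) : (deg g).natAbs < m * n := by
  have : NeZero m := ⟨by omega⟩
  obtain ⟨l, rfl, hl, rfl⟩ := hg
  refine (deg_prod_lt_or hm hl).resolve_right ?_
  rintro ⟨-, i, hi⟩
  have := len_x_zpow_le (m := m) i
  rw [hi] at h
  omega

end abelianization

theorem finite_and_ncard_le {α : Type*} {S : Set α} {n : ℕ} {f : ℕ → ℤ → α} {k₀ : ℕ → ℤ}
    (h : ∀ s ∈ S, ∃ j < 2 * n, ∃ k, k₀ j ≤ k ∧ 2 * (k - k₀ j) < n ∧ f j k = s) :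
    S.Finite ∧ S.ncard ≤ n * (n + 1) := by
  classical
  set T : Finset α := (Finset.range (2 * n)).biUnion fun j =>
    (Finset.Icc (k₀ j) (k₀ j + (n - 1) / 2)).image (f j) with hT
  have hST : S ⊆ T := by
    intro s hs
    obtain ⟨j, hj, k, hk, hk', rfl⟩ := h s hs
    simp only [hT, Finset.mem_coe, Finset.mem_biUnion, Finset.mem_range]
    exact ⟨j, hj, Finset.mem_image_of_mem _ (Finset.mem_Icc.2 ⟨hk, by omega⟩)⟩
  refine ⟨T.finite_toSet.subset hST, ?_⟩
  calc S.ncard ≤ T.card := by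
        rw [← Set.ncard_coe_finset]
        exact Set.ncard_le_ncard hST T.finite_toSet
    _ ≤ (Finset.range (2 * n)).card * ((n + 1) / 2) := by
        refine Finset.card_biUnion_le_card_mul _ _ _ fun j _ => Finset.card_image_le.trans ?_
        rw [Int.card_Icc]
        omega
    _ ≤ n * (n + 1) := by
        rw [Finset.card_range, mul_comm 2 n, mul_assoc]
        exact Nat.mul_le_mul_left n (by omega)

section twisted

variable {m : ℕ} {φ : MulAut (TorusGrp m)} {g : TorusGrp m}

theorem inv_conj_mem (hφ : ∀ a ∈ genSet m, φ a = a⁻¹) {a h : TorusGrp m} (ha : a ∈ genSet m)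
    (hh : twistedConj φ h g) : twistedConj φ (a * h * a) g := by
  obtain ⟨u, rfl⟩ := hh
  refine ⟨a⁻¹ * u, ?_⟩
  rw [map_mul, map_inv, hφ a ha]
  group

theorem one_mem_of_y_zpow_mem {C : Set (TorusGrp m)}
    (hC : ∀ a ∈ genSet m, ∀ h ∈ C, a * h * a ∈ C) (hodd : Odd m) {e : ℤ} (he : yg m ^ e ∈ C) :
    1 ∈ C := by
  have heven (j : ℤ) (hj : yg m ^ (j + j) ∈ C) : 1 ∈ C := by
    have := conj_y_mem hC hj (-j)
    rwa [← zpow_add, ← zpow_add, show -j + (j + j) + -j = 0 by ring, zpow_zero] at this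
  obtain ⟨j, rfl⟩ | he' := e.even_or_odd
  · exact heven j he
  · obtain ⟨j, hj⟩ := he'.sub_odd ((Int.odd_coe_nat m).2 hodd)
    have h1 := conj_y_mem hC he (-j)
    rw [← zpow_add, ← zpow_add, show -j + e + -j = m by omega, zpow_natCast, yg_pow] at h1
    have h2 := hC (xg m)⁻¹ (by simp [genSet]) _ h1
    rwa [← xg_mul_self, inv_mul_cancel_left, mul_inv_cancel] at h2

theorem Tower.of_twistedConj [NeZero m] (hodd : Odd m) (hφ : ∀ a ∈ genSet m, φ a = a⁻¹)
    {C : Set (TorusGrp m)} {n : ℕ} {w : List (TorusGrp m)} (hC : IsMinClass C n)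
    (hw : IsMinWord C n w) {t h : TorusGrp m} (ht : Tower w t) (htg : twistedConj φ t g)
    (hhg : twistedConj φ h g) : Tower w h := by
  have key (p : TorusGrp m) : ∀ t, Tower w t → Tower w ((φ p)⁻¹ * t * p) := by
    induction p using induction_left with
    | one => simp
    | mul a ha p ih =>
      intro t ht
      have := ih _ (ht.conj_mem hodd hC hw ha)
      rw [map_mul, hφ a ha]
      convert this using 1
      group
  obtain ⟨u, rfl⟩ := htg
  obtain ⟨v, hv⟩ := hhg
  convert key (u * v⁻¹) t ht using 1
  calc h = φ v * ((φ v)⁻¹ * h * v) * v⁻¹ := by group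
    _ = _ := by rw [← hv, map_mul, map_inv]; group

end twisted

end TorusKnot

open TorusKnot

/-- If `n ≥ 2` is the minimal word length in the `φ`-twisted conjugacy class of `g`, then the
set of minimal-length elements of that class is finite of cardinality at most `n(n+1)`. -/
theorem minimal_twisted_reps_quadratic (m : ℕ) (hm : 3 ≤ m) (hodd : Odd m)
    (φ : MulAut (TorusGrp m)) (hφx : φ (xg m) = (xg m)⁻¹) (hφy : φ (yg m) = (yg m)⁻¹)
    (g : TorusGrp m) (n : ℕ)
    (hn : n = sInf {k | ∃ h : TorusGrp m, twistedConj φ h g ∧ wordLen m h = k})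
    (hn2 : 2 ≤ n) :
    {h : TorusGrp m | twistedConj φ h g ∧ wordLen m h = n}.Finite ∧
    {h : TorusGrp m | twistedConj φ h g ∧ wordLen m h = n}.ncard ≤ n * (n + 1) := by
  have : NeZero m := ⟨by omega⟩
  have hφ : ∀ a ∈ genSet m, φ a = a⁻¹ := by
    rintro a (rfl | rfl | rfl | rfl) <;> simp [hφx, hφy]
  set C : Set (TorusGrp m) := {h | twistedConj φ h g} with hCdef
  have hconj : ∀ a ∈ genSet m, ∀ h ∈ C, a * h * a ∈ C := fun a ha h hh => inv_conj_mem hφ ha hh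
  have hmin {h : TorusGrp m} (hh : h ∈ C) {k : ℕ} (hk : Spelled h k) : n ≤ k :=
    (hn.trans_le (Nat.sInf_le ⟨h, hh, rfl⟩)).trans hk.wordLen_le
  have hpow (e : ℤ) : yg m ^ e ∉ C := fun he => by
    have := hmin (one_mem_of_y_zpow_mem hconj hodd he) spelled_one
    omega
  have hC : IsMinClass C n := by
    refine ⟨hconj, fun h hh => ?_, hn2, hpow⟩
    obtain ⟨e, rfl⟩ | ⟨a, s, b, hs⟩ := zpow_or_rep h
    · exact absurd hh (hpow e)
    · obtain ⟨k, hk⟩ := hs.exists_spelled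
      exact hmin (Δg_mul_mem hconj hh k) hk
  have hspell {h : TorusGrp m} (hh : wordLen m h = n) : Spelled h n :=
    hh ▸ spelled_wordLen (by omega)
  obtain ⟨h₀, hh₀, hh₀n⟩ : ∃ h, h ∈ C ∧ wordLen m h = n := by
    have := Nat.sInf_mem (Nat.nonempty_of_pos_sInf (hn ▸ (by omega : 0 < n)))
    rwa [← hn] at this
  obtain ⟨w, hwn, hwl, rfl⟩ := hspell hh₀n
  have hw : IsMinWord C n w := ⟨hwl, hwn, hh₀⟩
  have htower : Tower w w.prod := by simpa using Tower.base (w := w) 0 ⟨0, 0, by simp⟩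
  refine finite_and_ncard_le (f := fun j k => Δg m ^ (2 * k) * ((rot^[j] w).prod))
    (k₀ := fun j => (-(m * n) - deg (rot^[j] w).prod) / (4 * m) + 1) ?_
  rintro h ⟨hh, hhn⟩
  have hlen : len h = n := by
    obtain ⟨l, hl, hlX, rfl⟩ := hspell hhn
    exact le_antisymm (hl ▸ len_prod_le hlX) (hC.le_len _ hh)
  obtain ⟨k, j, hkj⟩ := (htower.of_twistedConj hodd hφ hC hw hh₀ hh).mem_rotations hodd hC hw hlen
  have hper : Function.IsPeriodicPt rot (2 * n) w := by
    rw [← hwn]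
    exact rot_iterate_two_mul_length w
  rw [← hper.iterate_mod_apply j] at hkj
  refine ⟨j % (2 * n), Nat.mod_lt _ (by omega), k, ?_⟩
  have hdeg := deg_natAbs_lt hm (hspell hhn) (by omega)
  generalize (rot^[j % (2 * n)] w).prod = p at hkj ⊢
  rw [hkj, deg_mul, deg_Δ_zpow] at hdeg
  generalize deg p = c at hdeg ⊢
  have hm0 : (0 : ℤ) < 4 * m := by omega
  have h1 := Int.mul_ediv_self_le (x := -(m * n) - c) hm0.ne'
  have h2 := Int.lt_mul_ediv_self_add (x := -(m * n) - c) hm0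
  have hdeg' : |2 * m * (2 * k) + c| < (m * n : ℤ) := by
    rw [Int.abs_eq_natAbs]
    exact_mod_cast hdeg
  obtain ⟨hlo, hhi⟩ := abs_lt.1 hdeg'
  refine ⟨?_, ?_, hkj.symm⟩
  · refine lt_of_mul_lt_mul_left (a := 4 * (m : ℤ)) ?_ hm0.le
    linarith
  · refine lt_of_mul_lt_mul_left (a := 2 * (m : ℤ)) ?_ (by omega)
    linarith
end
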